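/- arXiv:math/0502211 — 2 statements merged into one kernel-verified Lean document; each statement's English description precedes it below -/
import Mathlib

section
/- Let D be a strongly self-absorbing C*-algebra satisfying the Universal Coefficients Theorem. Then K₁(D) = 0, and K₀(D) is group isomorphic to one of: the trivial group 0, ℤ, or the K₀-group of a UHF algebra of infinite type (i.e., a nontrivial subgroup of ℚ containing 1 and closed under x ↦ x² and squares of denominators, namely such that 1/m in the group implies 1/m² in the group). Moreover, if K₀(D) ≅ ℤ, then the class [1_D] of the unit is a generator of K₀(D). -/
open scoped MultiplierAlgebra TensorProduct
open Filter Topology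

noncomputable section

universe u v w x

/-- Approximate unitary equivalence of two maps `φ ψ : A → B`, witnessed by a sequence of
unitaries in the multiplier algebra `𝓜(ℂ, B)` (in which `B` embeds canonically). -/
def ApproxUnitaryEquiv {A : Type u} {B : Type v} [NonUnitalCStarAlgebra B]
    (φ ψ : A → B) : Prop :=
  ∃ v : ℕ → 𝓜(ℂ, B), (∀ n, v n ∈ unitary 𝓜(ℂ, B)) ∧
    ∀ a : A, Tendsto
      (fun n => ‖star (v n) * (φ a : 𝓜(ℂ, B)) * v n - (ψ a : 𝓜(ℂ, B))‖)
      atTop (𝓝 (0 : ℝ))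

/-- Data exhibiting `T` as a C*-tensor product of `A` and `B`: a bilinear, multiplicative,
star-preserving, cross-normed map `A × B → T` with dense span. -/
structure CStarTensor (A : Type u) (B : Type v) (T : Type w) [NonUnitalCStarAlgebra A]
    [NonUnitalCStarAlgebra B] [NonUnitalCStarAlgebra T] where
  tmul : A → B → T
  add_left : ∀ a a' b, tmul (a + a') b = tmul a b + tmul a' b
  add_right : ∀ a b b', tmul a (b + b') = tmul a b + tmul a b'
  smul_left : ∀ (c : ℂ) a b, tmul (c • a) b = c • tmul a b
  smul_right : ∀ (c : ℂ) a b, tmul a (c • b) = c • tmul a b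
  mul_tmul : ∀ a a' b b', tmul a b * tmul a' b' = tmul (a * a') (b * b')
  star_tmul : ∀ a b, star (tmul a b) = tmul (star a) (star b)
  norm_tmul : ∀ a b, ‖tmul a b‖ = ‖a‖ * ‖b‖
  dense_span : Dense ((Submodule.span ℂ {t : T | ∃ a b, tmul a b = t} : Submodule ℂ T) : Set T)

/-- Data exhibiting `T` as *the minimal (spatial) tensor product* of `A` and `B`: a C*-tensor
product which is dominated by every other C*-tensor product of `A` and `B` (i.e., it carries
the smallest C*-norm). -/
structure MinTensor (A : Type u) (B : Type v) (T : Type w) [NonUnitalCStarAlgebra A]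
    [NonUnitalCStarAlgebra B] [NonUnitalCStarAlgebra T] extends CStarTensor A B T where
  minimal : ∀ (T' : Type (max u v)) [NonUnitalCStarAlgebra T'] (h : CStarTensor A B T'),
    ∃ π : T' →⋆ₙₐ[ℂ] T, ∀ a b, π (h.tmul a b) = tmul a b

/-- The first-factor unital embedding `d ↦ d ⊗ 1`. -/
def MinTensor.fst {D : Type u} {E : Type v} {T : Type w} [CStarAlgebra D] [CStarAlgebra E]
    [CStarAlgebra T] (h : MinTensor D E T) : D → T := fun d => h.tmul d 1

/-- The second-factor unital embedding `d ↦ 1 ⊗ d`. -/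
def MinTensor.snd {D : Type u} {E : Type v} {T : Type w} [CStarAlgebra D] [CStarAlgebra E]
    [CStarAlgebra T] (h : MinTensor D E T) : E → T := fun d => h.tmul 1 d

/-- A unital C*-algebra `D` has *approximately inner half flip* (with respect to a
realization `T` of the minimal tensor product `D ⊗ D`) if the two factor embeddings
`id_D ⊗ 1_D` and `1_D ⊗ id_D` of `D` into `D ⊗ D` are approximately unitarily equivalent. -/
def HasApproxInnerHalfFlip {D : Type u} {T : Type w} [CStarAlgebra D] [CStarAlgebra T]
    (h : MinTensor D D T) : Prop :=
  ApproxUnitaryEquiv h.fst h.snd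

/-- A unital C*-algebra `D` has *approximately inner flip* (with respect to a realization
`T` of `D ⊗ D`) if the flip automorphism `σ_D : a ⊗ b ↦ b ⊗ a` of `D ⊗ D` is approximately
unitarily equivalent to the identity map. -/
def HasApproxInnerFlip {D : Type u} {T : Type w} [CStarAlgebra D] [CStarAlgebra T]
    (h : MinTensor D D T) : Prop :=
  ∃ σ : T ≃⋆ₐ[ℂ] T, (∀ a b, σ (h.tmul a b) = h.tmul b a) ∧
    ApproxUnitaryEquiv (⇑σ) (id : T → T)

/-- A unital C*-algebra `D ≇ ℂ` is *strongly self-absorbing* (with respect to a realization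
`T` of the minimal tensor product `D ⊗ D`) if there is an isomorphism `φ : D → D ⊗ D` which
is approximately unitarily equivalent to `id_D ⊗ 1_D`. -/
def IsStronglySelfAbsorbing {D : Type u} {T : Type w} [CStarAlgebra D] [CStarAlgebra T]
    (h : MinTensor D D T) : Prop :=
  IsEmpty (D ≃⋆ₐ[ℂ] ℂ) ∧ ∃ φ : D ≃⋆ₐ[ℂ] T, ApproxUnitaryEquiv (⇑φ) h.fst

/-- The relations submodule of the canonical free presentation `0 → K → ℤ[G] → G → 0`
of an abelian group `G`. -/
def torRelations (G : Type v) [AddCommGroup G] : Submodule ℤ (G →₀ ℤ) :=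
  LinearMap.ker (Finsupp.linearCombination ℤ (id : G → G))

/-- The map `K ⊗ H → ℤ[G] ⊗ H` induced by the canonical free presentation of `G`. -/
def torMap (G H : Type v) [AddCommGroup G] [AddCommGroup H] :
    TensorProduct ℤ (torRelations G) H →ₗ[ℤ] TensorProduct ℤ (G →₀ ℤ) H :=
  TensorProduct.map (Submodule.subtype (torRelations G)) (LinearMap.id : H →ₗ[ℤ] H)

/-- The first Tor group `Tor₁ᶻ(G, H)` of two abelian groups, computed from the canonical
free presentation `0 → K → ℤ[G] → G → 0`: it is the kernel of `K ⊗ H → ℤ[G] ⊗ H`. -/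
def Tor1 (G H : Type v) [AddCommGroup G] [AddCommGroup H] : Type v :=
  LinearMap.ker (torMap G H)

noncomputable instance (G H : Type v) [AddCommGroup G] [AddCommGroup H] :
    AddCommGroup (Tor1 G H) :=
  inferInstanceAs (AddCommGroup (LinearMap.ker (torMap G H)))

/-- If `Tor₁(G, G)` vanishes then `G` is torsion-free. -/
theorem eq_zero_of_zsmul_eq_zero_of_subsingleton_tor1 {G : Type v} [AddCommGroup G]
    [Subsingleton (Tor1 G G)] {n : ℤ} (hn : n ≠ 0) {g : G} (hg : n • g = 0) : g = 0 := by
  have hd : (addOrderOf g : ℤ) ∣ n := addOrderOf_dvd_iff_zsmul_eq_zero.2 hg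
  set d : ℤ := (addOrderOf g : ℤ)
  have hd0 : d ≠ 0 := fun h0 => hn (by rwa [h0, zero_dvd_iff] at hd)
  have hdg : d • g = 0 := addOrderOf_dvd_iff_zsmul_eq_zero.1 dvd_rfl
  let r : torRelations G := ⟨Finsupp.single g d, by simp [torRelations, hdg]⟩
  have hr : r ⊗ₜ[ℤ] g ∈ LinearMap.ker (torMap G G) := by
    change (Finsupp.single g d : G →₀ ℤ) ⊗ₜ[ℤ] g = 0
    rw [show (Finsupp.single g d : G →₀ ℤ) = d • Finsupp.single g 1 by simp,
      TensorProduct.smul_tmul, hdg, TensorProduct.tmul_zero]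
  have hr0 : r ⊗ₜ[ℤ] g = 0 :=
    congrArg Subtype.val (Subsingleton.elim (α := Tor1 G G) ⟨r ⊗ₜ[ℤ] g, hr⟩ 0)
  have hgr : g ⊗ₜ[ℤ] r = 0 := by
    simpa using congrArg (TensorProduct.comm ℤ (torRelations G) G) hr0
  obtain ⟨k, a, y, hy, ha⟩ :=
    TensorProduct.vanishesTrivially_of_sum_tmul_eq_zero_of_rTensor_injective ℤ
      (m := fun _ : Fin 1 => g) (n := fun _ => r)
      (Module.Flat.rTensor_preserves_injective_linearMap _ (Submodule.subtype_injective _))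
      (by simpa using hgr)
  have hda : ∀ j, d ∣ a 0 j := fun j =>
    addOrderOf_dvd_iff_zsmul_eq_zero.2 (by simpa using ha j)
  choose b hb using hda
  have hrs : r = d • ∑ j, b j • y j := by
    rw [show r = _ from hy 0, Finset.smul_sum]
    exact Finset.sum_congr rfl fun j _ => by rw [hb, mul_smul]
  have hs : Finsupp.single g (1 : ℤ) = (∑ j, b j • y j : torRelations G).1 := by
    have h1 : (Finsupp.single g d : G →₀ ℤ) = d • (∑ j, b j • y j : torRelations G).1 :=
      congrArg Subtype.val hrs
    refine smul_right_injective _ hd0 ?_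
    simpa using h1
  have hmem : Finsupp.single g (1 : ℤ) ∈ torRelations G := hs ▸ Subtype.property _
  simpa [torRelations] using hmem

/-- A nonzero element of a torsion-free abelian group is sent to `1` by some homomorphism
to `ℚ`. -/
theorem exists_addMonoidHom_rat_eq_one {G : Type v} [AddCommGroup G] {x : G}
    (hx : ∀ n : ℤ, n • x = 0 → n = 0) : ∃ f : G →+ ℚ, f x = 1 := by
  have hinj : Function.Injective (zmultiplesHom G x) :=
    (injective_iff_map_eq_zero _).2 fun n hn => hx n (by simpa using hn)
  obtain ⟨f, hf⟩ := (Module.Baer.of_divisible ℚ).extension_property_addMonoidHom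
    (zmultiplesHom G x) hinj (Int.castAddHom ℚ)
  exact ⟨f, by simpa using DFunLike.congr_fun hf 1⟩

/-- The product of two homomorphisms to `ℚ`, as a homomorphism on the tensor product. -/
def tensorMulRat {G H : Type v} [AddCommGroup G] [AddCommGroup H] (f : G →+ ℚ) (g : H →+ ℚ) :
    TensorProduct ℤ G H →ₗ[ℤ] ℚ :=
  LinearMap.mul' ℤ ℚ ∘ₗ TensorProduct.map f.toIntLinearMap g.toIntLinearMap

theorem tensorMulRat_tmul {G H : Type v} [AddCommGroup G] [AddCommGroup H] (f : G →+ ℚ)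
    (g : H →+ ℚ) (x : G) (y : H) : tensorMulRat f g (x ⊗ₜ[ℤ] y) = f x * g y := rfl

/-- A nonzero torsion-free abelian group `G` for which `x ↦ x ⊗ u` maps onto `G ⊗ G` embeds
in `ℚ`, with `u ↦ 1` and with image closed under multiplication. -/
theorem exists_injective_addMonoidHom_rat {G : Type v} [AddCommGroup G] [Nontrivial G]
    (htf : ∀ (n : ℤ) (g : G), n ≠ 0 → n • g = 0 → g = 0) {u : G}
    (hu : Function.Surjective fun x : G => x ⊗ₜ[ℤ] u) :
    ∃ f : G →+ ℚ, Function.Injective f ∧ f u = 1 ∧ ∀ x y, ∃ z, f z = f x * f y := by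
  have hex : ∀ x : G, x ≠ 0 → ∃ f : G →+ ℚ, f x = 1 := fun x hx =>
    exists_addMonoidHom_rat_eq_one fun n hn => by_contra fun hn0 => hx (htf n x hn0 hn)
  have hu0 : u ≠ 0 := by
    rintro rfl
    obtain ⟨x, hx⟩ := exists_ne (0 : G)
    obtain ⟨f, hf⟩ := hex x hx
    obtain ⟨y, hy⟩ := hu (x ⊗ₜ[ℤ] x)
    have h1 := congrArg (tensorMulRat f f) hy
    simp [tensorMulRat_tmul, hf] at h1
  obtain ⟨f, hf⟩ := hex u hu0
  refine ⟨f, (injective_iff_map_eq_zero _).2 fun x hx => ?_, hf, fun x y => ?_⟩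
  · by_contra hx0
    obtain ⟨g, hg⟩ := hex x hx0
    obtain ⟨y, hy⟩ := hu (u ⊗ₜ[ℤ] x)
    have h1 := congrArg (tensorMulRat f f) hy
    have h2 := congrArg (tensorMulRat f g) hy
    simp only [tensorMulRat_tmul, hf, hg, hx, mul_one, mul_zero] at h1 h2
    simp [h1] at h2
  · obtain ⟨z, hz⟩ := hu (x ⊗ₜ[ℤ] y)
    have h1 := congrArg (tensorMulRat f f) hz
    simp only [tensorMulRat_tmul, hf, mul_one] at h1
    exact ⟨z, h1⟩

/-- A torsion-free abelian group `G` for which `x ↦ x ⊗ u` maps onto `G ⊗ G` is zero, or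
infinite cyclic with generator `u`, or a subring of `ℚ` other than `ℤ`. -/
theorem classification_of_surjective_tmul {G : Type v} [AddCommGroup G]
    (htf : ∀ (n : ℤ) (g : G), n ≠ 0 → n • g = 0 → g = 0) {u : G}
    (hu : Function.Surjective fun x : G => x ⊗ₜ[ℤ] u) :
    Subsingleton G ∨ (Nonempty (G ≃+ ℤ) ∧ AddSubgroup.zmultiples u = ⊤) ∨
      ∃ S : AddSubgroup ℚ, (1 : ℚ) ∈ S ∧
        (∀ m : ℕ, ((m : ℚ))⁻¹ ∈ S → (((m : ℚ)) ^ 2)⁻¹ ∈ S) ∧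
        (∃ x ∈ S, x ∉ Set.range ((↑) : ℤ → ℚ)) ∧ Nonempty (G ≃+ S) := by
  rcases subsingleton_or_nontrivial G with hG | hG
  · exact Or.inl hG
  obtain ⟨f, hf, hfu, hmul⟩ := exists_injective_addMonoidHom_rat htf hu
  right
  by_cases hZ : ∀ x, f x ∈ Set.range ((↑) : ℤ → ℚ)
  · left
    have hgen : ∀ x : G, ∃ n : ℤ, n • u = x := fun x => by
      obtain ⟨n, hn⟩ := hZ x
      exact ⟨n, hf (by simp [hfu, hn])⟩
    have hbij : Function.Bijective (zmultiplesHom G u) := by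
      refine ⟨(injective_iff_map_eq_zero _).2 fun n hn => ?_, fun x => by simpa using hgen x⟩
      simpa [hfu] using congrArg f hn
    exact ⟨⟨(AddEquiv.ofBijective _ hbij).symm⟩,
      (AddSubgroup.eq_top_iff' _).2 fun x => AddSubgroup.mem_zmultiples_iff.2 (hgen x)⟩
  · right
    push Not at hZ
    obtain ⟨x, hx⟩ := hZ
    refine ⟨f.range, ⟨u, hfu⟩, ?_, ⟨f x, ⟨x, rfl⟩, hx⟩, ⟨AddMonoidHom.ofInjective hf⟩⟩
    rintro m ⟨y, hy⟩
    obtain ⟨z, hz⟩ := hmul y y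
    exact ⟨z, by rw [hz, hy, sq, mul_inv]⟩

/-- In a short exact sequence `0 → A → B → C → 0`, surjectivity of `A → B` forces `C = 0`. -/
theorem subsingleton_of_exact_of_surjective {A B C : Type*} [AddCommGroup B] [AddCommGroup C]
    {j : A → B} {p : B →+ C} (hp : Function.Surjective p)
    (hexact : ∀ x, p x = 0 ↔ x ∈ Set.range j) (hj : Function.Surjective j) :
    Subsingleton C :=
  subsingleton_of_forall_eq 0 fun c => by
    obtain ⟨b, rfl⟩ := hp c
    exact (hexact b).2 (hj b)

/-- Let `D` be a strongly self-absorbing C*-algebra satisfying the Universal Coefficients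
Theorem, the latter being expressed (following Rosenberg–Schochet) through the natural
Künneth short exact sequences
`0 → (K₀D ⊗ K₀D) ⊕ (K₁D ⊗ K₁D) → K₀(D ⊗ D) → Tor(K₀D, K₁D) ⊕ Tor(K₁D, K₀D) → 0` and
`0 → (K₀D ⊗ K₁D) ⊕ (K₁D ⊗ K₀D) → K₁(D ⊗ D) → Tor(K₀D, K₀D) ⊕ Tor(K₁D, K₁D) → 0`,
where the K-groups are abstract abelian groups `G0 = K₀(D)`, `G1 = K₁(D)`,
`K0T = K₀(D ⊗ D)`, `K1T = K₁(D ⊗ D)`, functorial and invariant under approximate unitary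
equivalence, with `u = [1_D] ∈ K₀(D)`, and the maps induced by `id_D ⊗ 1_D` are
`x ↦ x ⊗ u` (naturality).  Then `K₁(D) = 0` and `K₀(D)` is isomorphic to `0`, to `ℤ`
(with `[1_D]` a generator), or to the `K₀`-group of a UHF algebra of infinite type, i.e.
a nontrivial subgroup of `ℚ` containing `1` such that `1/m ∈ G` implies `1/m² ∈ G`. -/
theorem stmt_18 {D T : Type u} [CStarAlgebra D] [CStarAlgebra T]
    [TopologicalSpace.SeparableSpace D]
    (h : MinTensor D D T) (hu : h.tmul 1 1 = 1)
    (hssa : IsStronglySelfAbsorbing h)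
    -- the K-groups of `D` and of `D ⊗ D`
    (G0 G1 K0T K1T : Type v)
    [AddCommGroup G0] [AddCommGroup G1] [AddCommGroup K0T] [AddCommGroup K1T]
    (u : G0)  -- the class `[1_D] ∈ K₀(D)`
    -- functoriality of `K₀`, `K₁` on unital *-homomorphisms `D → D ⊗ D`
    (k0 : (D →⋆ₐ[ℂ] T) → (G0 →+ K0T)) (k1 : (D →⋆ₐ[ℂ] T) → (G1 →+ K1T))
    -- K-theory is invariant under approximate unitary equivalence
    (k0_au : ∀ f g : D →⋆ₐ[ℂ] T, ApproxUnitaryEquiv (⇑f) (⇑g) → k0 f = k0 g)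
    (k1_au : ∀ f g : D →⋆ₐ[ℂ] T, ApproxUnitaryEquiv (⇑f) (⇑g) → k1 f = k1 g)
    -- K-theory sends isomorphisms to isomorphisms
    (k0_iso : ∀ (e : D ≃⋆ₐ[ℂ] T) (f : D →⋆ₐ[ℂ] T), (∀ x, f x = e x) →
      Function.Bijective (k0 f))
    (k1_iso : ∀ (e : D ≃⋆ₐ[ℂ] T) (f : D →⋆ₐ[ℂ] T), (∀ x, f x = e x) →
      Function.Bijective (k1 f))
    -- the Künneth (UCT) short exact sequence for the pair `(D, D)`, in degree 0 …
    (j0 : (TensorProduct ℤ G0 G0) × (TensorProduct ℤ G1 G1) →+ K0T)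
    (p0 : K0T →+ (Tor1 G0 G1) × (Tor1 G1 G0))
    (hj0 : Function.Injective j0) (hp0 : Function.Surjective p0)
    (hexact0 : ∀ x : K0T, p0 x = 0 ↔ x ∈ Set.range j0)
    -- … and in degree 1
    (j1 : (TensorProduct ℤ G0 G1) × (TensorProduct ℤ G1 G0) →+ K1T)
    (p1 : K1T →+ (Tor1 G0 G0) × (Tor1 G1 G1))
    (hj1 : Function.Injective j1) (hp1 : Function.Surjective p1)
    (hexact1 : ∀ x : K1T, p1 x = 0 ↔ x ∈ Set.range j1)
    -- naturality: the K-theory maps induced by `id_D ⊗ 1_D : D → D ⊗ D` are `x ↦ x ⊗ [1_D]`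
    (incl : D →⋆ₐ[ℂ] T) (hincl : ∀ d, incl d = h.tmul d 1)
    (hnat0 : ∀ x : G0, k0 incl x = j0 (x ⊗ₜ[ℤ] u, 0))
    (hnat1 : ∀ x : G1, k1 incl x = j1 (0, x ⊗ₜ[ℤ] u)) :
    -- conclusion: `K₁(D) = 0`, and `K₀(D)` is `0`, `ℤ` (generated by `[1_D]`), or the
    -- `K₀`-group of a UHF algebra of infinite type
    Subsingleton G1 ∧
      (Subsingleton G0 ∨
        (Nonempty (G0 ≃+ ℤ) ∧ AddSubgroup.zmultiples u = ⊤) ∨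
        ∃ G : AddSubgroup ℚ, (1 : ℚ) ∈ G ∧
          (∀ m : ℕ, ((m : ℚ))⁻¹ ∈ G → (((m : ℚ)) ^ 2)⁻¹ ∈ G) ∧
          (∃ x ∈ G, x ∉ Set.range ((↑) : ℤ → ℚ)) ∧
          Nonempty (G0 ≃+ G)) := by
  obtain ⟨-, φ, hφ⟩ := hssa
  have hfst : ⇑incl = h.fst := funext hincl
  have hau : ApproxUnitaryEquiv ⇑(φ : D →⋆ₐ[ℂ] T) ⇑incl := hfst ▸ hφ
  have hbij0 : Function.Bijective (k0 incl) :=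
    k0_au _ _ hau ▸ k0_iso φ (φ : D →⋆ₐ[ℂ] T) fun _ => rfl
  have hbij1 : Function.Bijective (k1 incl) :=
    k1_au _ _ hau ▸ k1_iso φ (φ : D →⋆ₐ[ℂ] T) fun _ => rfl
  have hsurj0 : ∀ z : TensorProduct ℤ G0 G0 × TensorProduct ℤ G1 G1,
      ∃ x : G0, (x ⊗ₜ[ℤ] u, 0) = z := fun z => by
    obtain ⟨x, hx⟩ := hbij0.2 (j0 z)
    exact ⟨x, hj0 (by rw [← hnat0, hx])⟩
  have hsurj1 : ∀ z : TensorProduct ℤ G0 G1 × TensorProduct ℤ G1 G0,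
      ∃ x : G1, (0, x ⊗ₜ[ℤ] u) = z := fun z => by
    obtain ⟨x, hx⟩ := hbij1.2 (j1 z)
    exact ⟨x, hj1 (by rw [← hnat1, hx])⟩
  have hj1_surj : Function.Surjective j1 := fun y => by
    obtain ⟨x, hx⟩ := hbij1.2 y
    exact ⟨(0, x ⊗ₜ[ℤ] u), by rw [← hnat1, hx]⟩
  have hTor : Subsingleton (Tor1 G0 G0) := by
    have := subsingleton_of_exact_of_surjective hp1 hexact1 hj1_surj
    exact (Prod.fst_surjective (β := Tor1 G1 G1)).subsingleton
  constructor
  · refine subsingleton_of_forall_eq 0 fun x => hbij1.1 ?_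
    obtain ⟨y, hy⟩ := hsurj1 (u ⊗ₜ[ℤ] x, 0)
    have h0 : u ⊗ₜ[ℤ] x = 0 := (congrArg Prod.fst hy).symm
    have h1 : x ⊗ₜ[ℤ] u = 0 := by simpa using congrArg (TensorProduct.comm ℤ G0 G1) h0
    rw [map_zero, hnat1, h1]
    exact map_zero j1
  · refine classification_of_surjective_tmul
      (fun n g hn => eq_zero_of_zsmul_eq_zero_of_subsingleton_tor1 hn) (u := u) fun z => ?_
    obtain ⟨x, hx⟩ := hsurj0 (z, 0)
    exact ⟨x, congrArg Prod.fst hx⟩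
end
end

section
/- Let D and E be strongly self-absorbing C*-algebras, and suppose there exist unital *-embeddings ι_D : D → E and ι_E : E → D. Then D and E are isomorphic. -/
open scoped MultiplierAlgebra TensorProduct
open Filter Topology

noncomputable section

universe u v w x

section Functionals

open scoped ComplexOrder

theorem exists_strongDual_comp_eq {V : Type*} {T : Type*} [AddCommGroup V] [Module ℂ V]
    [NormedAddCommGroup T] [NormedSpace ℂ T] (Θ : V →ₗ[ℂ] T) (l : V →ₗ[ℂ] ℂ)
    (hl : ∀ z, ‖l z‖ ≤ ‖Θ z‖) :
    ∃ ρ : StrongDual ℂ T, ‖ρ‖ ≤ 1 ∧ ∀ z, ρ (Θ z) = l z := by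
  obtain ⟨s, hs⟩ := Θ.rangeRestrict.exists_rightInverse_of_surjective Θ.range_rangeRestrict
  have hs' : ∀ y, Θ (s y) = y := fun y => congrArg Subtype.val (LinearMap.congr_fun hs y)
  let m : StrongDual ℂ (LinearMap.range Θ) := (l ∘ₗ s).mkContinuous 1 fun y => by
    simpa [hs'] using hl (s y)
  obtain ⟨ρ, hρ, hn⟩ := exists_extension_norm_eq _ m
  refine ⟨ρ, hn ▸ LinearMap.mkContinuous_norm_le _ zero_le_one _, fun z => ?_⟩
  have h1 : ρ (Θ z) = l (s (Θ.rangeRestrict z)) := hρ (Θ.rangeRestrict z)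
  have h2 := hl (s (Θ.rangeRestrict z) - z)
  rw [map_sub Θ, hs', LinearMap.codRestrict_apply, sub_self, norm_zero, norm_le_zero_iff, map_sub,
    sub_eq_zero] at h2
  rw [h1, h2]

variable {A : Type*} [CStarAlgebra A] [PartialOrder A] [StarOrderedRing A]

theorem PositiveLinearMap.norm_apply_le_map_one (f : A →ₚ[ℂ] ℂ) (a : A) :
    ‖f a‖ ≤ (f 1).re * ‖a‖ := by
  have h1 : ‖f.toPreGNS 1‖ ^ 2 = (f 1).re := by
    have := congrArg Complex.re (f.preGNS_norm_sq (f.toPreGNS 1))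
    rw [← Complex.ofReal_pow, Complex.ofReal_re] at this
    simpa using this
  have h2 : f a = inner ℂ (f.toPreGNS 1) (f.leftMulMapPreGNS a (f.toPreGNS 1)) := by
    simp [preGNS_inner_def]
  have h3 : ‖f.leftMulMapPreGNS a‖ ≤ ‖a‖ := LinearMap.mkContinuous_norm_le _ (norm_nonneg _) _
  calc ‖f a‖ ≤ ‖f.toPreGNS 1‖ * ‖f.leftMulMapPreGNS a (f.toPreGNS 1)‖ := by
        rw [h2]; exact norm_inner_le_norm _ _
    _ ≤ ‖f.toPreGNS 1‖ * (‖a‖ * ‖f.toPreGNS 1‖) := by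
        gcongr; exact (f.leftMulMapPreGNS a).le_of_opNorm_le h3 _
    _ = _ := by rw [← h1]; ring

theorem exists_positiveLinearMap_of_norm_le_one (ρ : StrongDual ℂ A) (hρ : ‖ρ‖ ≤ 1)
    (h1 : ρ 1 = 1) : ∃ f : A →ₚ[ℂ] ℂ, ∀ a, f a = ρ a := by
  have hle : ∀ a, ‖ρ a‖ ≤ ‖a‖ := fun a => by simpa using ρ.le_of_opNorm_le hρ a
  have him : ∀ a : A, IsSelfAdjoint a → (ρ a).im = 0 := by
    intro a ha
    by_contra hne
    have key : ∀ t : ℝ, ((ρ a).im + t) ^ 2 ≤ ‖a‖ ^ 2 + t ^ 2 := by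
      intro t
      have e1 : ρ (a + (t * Complex.I : ℂ) • (1 : A)) = ρ a + t * Complex.I := by simp [h1]
      have e2 := hle (a + (t * Complex.I : ℂ) • (1 : A))
      rw [e1] at e2
      have e3 : star (a + (t * Complex.I : ℂ) • (1 : A)) * (a + (t * Complex.I : ℂ) • (1 : A))
          = a * a + ((t ^ 2 : ℝ) : ℂ) • (1 : A) := by
        simp only [star_add, star_smul, star_one, ha.star_eq, add_mul, mul_add, smul_mul_assoc,
          mul_smul_comm, one_mul, mul_one, smul_add, smul_smul]
        simp only [RCLike.star_def, map_mul, Complex.conj_ofReal, Complex.conj_I]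
        have : (t * Complex.I * (t * -Complex.I) : ℂ) = ((t ^ 2 : ℝ) : ℂ) := by
          push_cast; linear_combination (-(t : ℂ) ^ 2) * Complex.I_sq
        rw [this]
        module
      have e4 : ‖a + (t * Complex.I : ℂ) • (1 : A)‖ ^ 2 ≤ ‖a‖ ^ 2 + t ^ 2 := by
        rw [sq, ← CStarRing.norm_star_mul_self, e3]
        refine (norm_add_le _ _).trans ?_
        rw [ha.norm_mul_self, norm_smul]
        have : ‖(1 : A)‖ ≤ 1 := by
          nontriviality A
          simp
        have h5 : ‖((t ^ 2 : ℝ) : ℂ)‖ = t ^ 2 := by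
          rw [Complex.norm_real, Real.norm_of_nonneg (sq_nonneg t)]
        rw [h5]
        nlinarith [sq_nonneg t]
      have e5 : ((ρ a).im + t) ^ 2 ≤ ‖ρ a + t * Complex.I‖ ^ 2 := by
        have := Complex.abs_im_le_norm (ρ a + t * Complex.I)
        simp only [Complex.add_im, Complex.mul_im, Complex.ofReal_re, Complex.I_im,
          Complex.ofReal_im, Complex.I_re, mul_one, mul_zero, add_zero] at this
        rw [← sq_abs]
        gcongr
      have e6 : ‖ρ a + t * Complex.I‖ ^ 2 ≤ ‖a + (t * Complex.I : ℂ) • (1 : A)‖ ^ 2 := by gcongr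
      linarith
    have := key ((‖a‖ ^ 2 + 1) / (ρ a).im)
    have h7 : (ρ a).im * ((‖a‖ ^ 2 + 1) / (ρ a).im) = ‖a‖ ^ 2 + 1 := by field_simp
    nlinarith [sq_nonneg (ρ a).im, sq_nonneg ‖a‖]
  refine ⟨PositiveLinearMap.mk₀ ρ.toLinearMap fun a ha => ?_, fun a => rfl⟩
  have him' := him a (IsSelfAdjoint.of_nonneg ha)
  rcases eq_or_ne a 0 with rfl | h0
  · simp
  have hpos : 0 < ‖a‖ := norm_pos_iff.mpr h0
  have hb : ‖(1 : A) - (‖a‖⁻¹ : ℂ) • a‖ ≤ 1 := by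
    have e : (1 : A) - (‖a‖⁻¹ : ℂ) • a = 1 - (‖a‖⁻¹ : ℝ) • a := by
      rw [← Complex.ofReal_inv, Complex.coe_smul]
    have hn : 0 ≤ (‖a‖⁻¹ : ℝ) • a := smul_nonneg (by positivity) ha
    have hn1 : (‖a‖⁻¹ : ℝ) • a ≤ 1 := by
      rw [← CStarAlgebra.norm_le_one_iff_of_nonneg _ hn, norm_smul]
      simp [hpos.ne']
    rw [e, CStarAlgebra.norm_le_one_iff_of_nonneg _ (sub_nonneg.mpr hn1)]
    exact sub_le_self _ hn
  have h8 := (hle _).trans hb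
  rw [map_sub, h1, map_smul, smul_eq_mul] at h8
  have h9 := (Complex.re_le_norm _).trans h8
  have h10 : (1 - (‖a‖⁻¹ : ℂ) * ρ a).re = 1 - ‖a‖⁻¹ * (ρ a).re := by
    rw [← Complex.ofReal_inv, Complex.sub_re, Complex.re_ofReal_mul, Complex.one_re]
  have h12 := (Complex.abs_re_le_norm _).trans h8
  rw [h10, abs_le] at h12
  have h11 : 0 ≤ (ρ a).re := by
    by_contra! hneg
    have : ‖a‖⁻¹ * (ρ a).re < 0 := mul_neg_of_pos_of_neg (by positivity) hneg
    linarith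
  exact Complex.nonneg_iff.mpr ⟨h11, him'.symm⟩

theorem exists_ne_zero_norm_mul_sub_le {a : A} (ha : 0 ≤ a) {ε : ℝ} (hε : 0 < ε) [Nontrivial A] :
    ∃ p : A, p ≠ 0 ∧ ‖a * p - (‖a‖ : ℂ) • p‖ ≤ ε * ‖p‖ := by
  let φ : ℝ → ℝ := fun t => max 0 (t - (‖a‖ - ε))
  have hφ : Continuous φ := by fun_prop
  have hsp : ∀ t ∈ spectrum ℝ a, 0 ≤ t ∧ t ≤ ‖a‖ := fun t ht =>
    ⟨spectrum_nonneg_of_nonneg ha ht, (le_abs_self t).trans (spectrum.norm_le_norm_of_mem ht)⟩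
  have hnorm : ε ≤ ‖cfc φ a‖ := by
    have := norm_apply_le_norm_cfc φ a (CStarAlgebra.norm_mem_spectrum_of_nonneg ha)
      hφ.continuousOn (IsSelfAdjoint.of_nonneg ha)
    refine le_trans ?_ this
    simp [φ, abs_of_pos hε, max_eq_right hε.le]
  refine ⟨cfc φ a, norm_pos_iff.mp (hε.trans_le hnorm), ?_⟩
  have e : a * cfc φ a - (‖a‖ : ℂ) • cfc φ a = cfc (fun t => t * φ t - ‖a‖ * φ t) a := by
    have hsa : IsSelfAdjoint a := IsSelfAdjoint.of_nonneg ha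
    rw [cfc_sub (fun t => t * φ t) (fun t => ‖a‖ * φ t) a, cfc_const_mul ‖a‖ φ a,
      cfc_mul (fun t => t) φ a, cfc_id' ℝ a, Complex.coe_smul]
  rw [e]
  refine (norm_cfc_le (by positivity) fun t ht => ?_).trans
    (mul_le_mul_of_nonneg_left hnorm hε.le)
  obtain ⟨h0, h1⟩ := hsp t ht
  rw [← sub_mul, Real.norm_eq_abs, abs_mul, abs_of_nonpos (by linarith),
    abs_of_nonneg (le_max_left _ _)]
  rcases le_total (t - (‖a‖ - ε)) 0 with h | h
  · simp only [φ, max_eq_left h]; nlinarith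
  · simp only [φ, max_eq_right h]; nlinarith

theorem exists_state_apply_ne_zero {a : A} (ha : 0 ≤ a) (h0 : a ≠ 0) :
    ∃ f : A →ₚ[ℂ] ℂ, f 1 = 1 ∧ f a = ‖a‖ := by
  have : Nontrivial A := ⟨a, 0, h0⟩
  let Θ : ℂ × ℂ →ₗ[ℂ] A := (LinearMap.toSpanSingleton ℂ A 1).coprod
    (LinearMap.toSpanSingleton ℂ A a)
  let l : ℂ × ℂ →ₗ[ℂ] ℂ := (LinearMap.toSpanSingleton ℂ ℂ 1).coprod
    (LinearMap.toSpanSingleton ℂ ℂ (‖a‖ : ℂ))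
  obtain ⟨ρ, hρ, h⟩ := exists_strongDual_comp_eq Θ l fun z => by
    refine le_of_forall_pos_le_add fun ε hε => ?_
    obtain ⟨p, hp, hle⟩ := exists_ne_zero_norm_mul_sub_le ha (ε := ε / (‖z.2‖ + 1)) (by positivity)
    have hp' : 0 < ‖p‖ := norm_pos_iff.mpr hp
    have e : l z • p = Θ z * p - z.2 • (a * p - (‖a‖ : ℂ) • p) := by
      simp only [l, Θ, LinearMap.coprod_apply, LinearMap.toSpanSingleton_apply, smul_eq_mul,
        add_mul, smul_mul_assoc, one_mul]
      module
    have h1 : ‖l z‖ * ‖p‖ ≤ ‖Θ z‖ * ‖p‖ + ‖z.2‖ * (ε / (‖z.2‖ + 1) * ‖p‖) := by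
      rw [← norm_smul, e]
      refine (norm_sub_le _ _).trans (add_le_add (norm_mul_le _ _) ?_)
      rw [norm_smul]
      gcongr
    have h2 : ‖z.2‖ * (ε / (‖z.2‖ + 1)) ≤ ε := by
      rw [mul_div_assoc', div_le_iff₀ (by positivity)]
      nlinarith [norm_nonneg z.2]
    refine le_of_mul_le_mul_right ?_ hp'
    nlinarith
  obtain ⟨f, hf⟩ := exists_positiveLinearMap_of_norm_le_one ρ hρ (by simpa [Θ, l] using h (1, 0))
  exact ⟨f, by rw [hf]; simpa [Θ, l] using h (1, 0), by rw [hf]; simpa [Θ, l] using h (0, 1)⟩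

end Functionals

section StateSpace

open scoped ComplexOrder

variable {B : Type*} [CStarAlgebra B] [PartialOrder B] [StarOrderedRing B]

theorem PositiveLinearMap.eq_zero_or_exists_state (f : B →ₚ[ℂ] ℂ) :
    (∀ b, f b = 0) ∨ ∃ f' : B →ₚ[ℂ] ℂ, f' 1 = 1 ∧ ∀ b, f b = f 1 * f' b := by
  have h1 : 0 ≤ f 1 := f.map_nonneg zero_le_one
  rcases eq_or_ne (f 1) 0 with h | h
  · left
    intro b
    simpa [h] using f.norm_apply_le_map_one b
  · right
    refine ⟨.mk₀ ((f 1)⁻¹ • f.toLinearMap) fun x hx => ?_, ?_, fun b => ?_⟩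
    · exact mul_nonneg (inv_nonneg.mpr h1) (f.map_nonneg hx)
    · exact inv_mul_cancel₀ h
    · exact (mul_inv_cancel_left₀ h _).symm

variable (B) in
/-- The state space of a unital C*-algebra, as a subset of its weak dual. -/
def stateSpace : Set (WeakDual ℂ B) := {g | ∃ f : B →ₚ[ℂ] ℂ, f 1 = 1 ∧ ∀ b, f b = g b}

theorem mem_stateSpace_iff {g : WeakDual ℂ B} :
    g ∈ stateSpace B ↔ ‖WeakDual.toStrongDual g‖ ≤ 1 ∧ g 1 = 1 := by
  constructor
  · rintro ⟨f, h1, hf⟩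
    refine ⟨ContinuousLinearMap.opNorm_le_bound _ zero_le_one fun b => ?_, by rw [← hf, h1]⟩
    have := f.norm_apply_le_map_one b
    rw [h1, hf] at this
    exact this
  · rintro ⟨h, h1⟩
    obtain ⟨f, hf⟩ := exists_positiveLinearMap_of_norm_le_one (WeakDual.toStrongDual g) h h1
    exact ⟨f, (hf 1).trans h1, hf⟩

theorem isCompact_stateSpace : IsCompact (stateSpace B) := by
  have : stateSpace B = (WeakDual.toStrongDual ⁻¹' Metric.closedBall 0 1) ∩ {g | g 1 = 1} := by
    ext g
    simp [mem_stateSpace_iff]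
  rw [this]
  exact (WeakDual.isCompact_closedBall 0 1).inter_right
    (isClosed_eq (WeakDual.eval_continuous 1) continuous_const)

theorem convex_stateSpace : Convex ℝ (stateSpace B) := by
  rintro g ⟨f, h1, hf⟩ g' ⟨f', h1', hf'⟩ s t hs ht hst
  refine ⟨.mk₀ ((s : ℂ) • f.toLinearMap + (t : ℂ) • f'.toLinearMap) fun x hx => ?_, ?_, fun b => ?_⟩
  · exact add_nonneg (mul_nonneg (by exact_mod_cast hs) (f.map_nonneg hx))
      (mul_nonneg (by exact_mod_cast ht) (f'.map_nonneg hx))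
  · change (s : ℂ) * f 1 + t * f' 1 = 1
    rw [h1, h1']
    exact_mod_cast (by simpa using hst)
  · change (s : ℂ) * f b + t * f' b = (s • g) b + (t • g') b
    rw [hf, hf']
    rfl

/-- The state of the weak dual underlying a normalised positive functional. -/
theorem PositiveLinearMap.exists_mem_stateSpace (f : B →ₚ[ℂ] ℂ) (h1 : f 1 = 1) :
    ∃ g ∈ stateSpace B, ∀ b, g b = f b := by
  let ρ : StrongDual ℂ B := f.toLinearMap.mkContinuous 1 fun b => by
    simpa [h1] using f.norm_apply_le_map_one b
  exact ⟨StrongDual.toWeakDual ρ, ⟨f, h1, fun b => rfl⟩, fun b => rfl⟩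

theorem closure_convexHull_extremePoints_stateSpace :
    closure (convexHull ℝ ((stateSpace B).extremePoints ℝ)) = stateSpace B := by
  have : LocallyConvexSpace ℝ (WeakDual ℂ B) :=
    inferInstanceAs (LocallyConvexSpace ℝ (WeakBilin (topDualPairing ℂ B)))
  exact closure_convexHull_extremePoints isCompact_stateSpace convex_stateSpace

theorem norm_apply_le_of_extreme {b : B} {r : ℝ}
    (h : ∀ g ∈ (stateSpace B).extremePoints ℝ, ‖g b‖ ≤ r) {g : WeakDual ℂ B}
    (hg : g ∈ stateSpace B) : ‖g b‖ ≤ r := by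
  have hsub : (stateSpace B).extremePoints ℝ ⊆ {g | ‖g b‖ ≤ r} := fun g hg => h g hg
  have hclosed : IsClosed {g : WeakDual ℂ B | ‖g b‖ ≤ r} := by
    have : Continuous fun g : WeakDual ℂ B => g b := WeakDual.eval_continuous b
    exact isClosed_le this.norm continuous_const
  have hhull : convexHull ℝ ((stateSpace B).extremePoints ℝ) ⊆ {g | ‖g b‖ ≤ r} := by
    refine convexHull_min hsub ?_
    intro g (hg : ‖g b‖ ≤ r) g' (hg' : ‖g' b‖ ≤ r) s t hs ht hst
    have : s • g b + t • g' b ∈ Metric.closedBall (0 : ℂ) r := convex_closedBall (0 : ℂ) r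
      (mem_closedBall_zero_iff.mpr hg) (mem_closedBall_zero_iff.mpr hg') hs ht hst
    exact mem_closedBall_zero_iff.mp this
  exact closure_minimal hhull hclosed
    (closure_convexHull_extremePoints_stateSpace.symm.subset hg)

/-- A positive functional dominated by a pure state is a multiple of it. -/
theorem apply_eq_mul_of_le_extreme {g : WeakDual ℂ B} (hg : g ∈ (stateSpace B).extremePoints ℝ)
    (h h' : B →ₚ[ℂ] ℂ) (hh : ∀ b, h b + h' b = g b) (b : B) : h b = h 1 * g b := by
  have h1 : g 1 = 1 := (mem_stateSpace_iff.mp hg.1).2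
  rcases h.eq_zero_or_exists_state with h0 | ⟨k, hk1, hk⟩
  · simp [h0]
  rcases h'.eq_zero_or_exists_state with h0 | ⟨k', hk1', hk'⟩
  · have hhg : ∀ b, h b = g b := fun b => by rw [← hh, h0, add_zero]
    rw [hhg, hhg, h1, one_mul]
  obtain ⟨l, hl, hlk⟩ := k.exists_mem_stateSpace hk1
  obtain ⟨l', hl', hlk'⟩ := k'.exists_mem_stateSpace hk1'
  have hp : 0 ≤ h 1 := h.map_nonneg zero_le_one
  have hp' : 0 ≤ h' 1 := h'.map_nonneg zero_le_one
  rcases hp.eq_or_lt with h0 | hp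
  · rw [hk, ← h0]; simp
  rcases hp'.eq_or_lt with h0 | hp'
  · have hhg : ∀ b, h b = g b := fun b => by rw [← hh, hk', ← h0]; simp
    rw [hhg, hhg, h1, one_mul]
  rw [Complex.lt_def] at hp hp'
  have e : ((h 1).re : ℂ) = h 1 := Complex.ext (by simp) (by simpa using hp.2)
  have e' : ((h' 1).re : ℂ) = h' 1 := Complex.ext (by simp) (by simpa using hp'.2)
  have hlg := (mem_extremePoints.mp hg).2 l hl l' hl' ⟨(h 1).re, (h' 1).re, hp.1, hp'.1, by
    have := congrArg Complex.re ((hh 1).trans h1)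
    simpa using this, by
      refine DFunLike.ext _ _ fun b => ?_
      change ((h 1).re : ℂ) * l b + ((h' 1).re : ℂ) * l' b = g b
      rw [e, e', hlk, hlk', ← hk, ← hk', hh]⟩
  rw [hk, ← hlk, hlg.1]

end StateSpace

namespace CStarTensor

open scoped ComplexOrder

variable {A B T : Type*} [CStarAlgebra A] [CStarAlgebra B] [CStarAlgebra T]

/-- The bilinear map underlying a C*-tensor product. -/
def tmulₗ (h : CStarTensor A B T) : A →ₗ[ℂ] B →ₗ[ℂ] T :=
  LinearMap.mk₂ ℂ h.tmul h.add_left h.smul_left h.add_right h.smul_right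

@[simp]
theorem tmulₗ_apply (h : CStarTensor A B T) (a : A) (b : B) : h.tmulₗ a b = h.tmul a b := rfl

@[simp]
theorem tmul_zero (h : CStarTensor A B T) (a : A) : h.tmul a 0 = 0 := map_zero (h.tmulₗ a)

@[simp]
theorem zero_tmul (h : CStarTensor A B T) (b : B) : h.tmul 0 b = 0 :=
  LinearMap.map_zero₂ h.tmulₗ b

/-- The map from the algebraic tensor product into a C*-tensor product. -/
def lift (h : CStarTensor A B T) : A ⊗[ℂ] B →ₗ[ℂ] T := TensorProduct.lift h.tmulₗ

@[simp]
theorem lift_tmul (h : CStarTensor A B T) (a : A) (b : B) : h.lift (a ⊗ₜ b) = h.tmul a b := rfl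

/-- The slice map `a ⊗ b ↦ f a • b` on the algebraic tensor product. -/
def sliceLeft [PartialOrder A] (f : A →ₚ[ℂ] ℂ) : A ⊗[ℂ] B →ₗ[ℂ] B :=
  TensorProduct.lift ((LinearMap.lsmul ℂ B : ℂ →ₗ[ℂ] B →ₗ[ℂ] B) ∘ₗ f.toLinearMap)

@[simp]
theorem sliceLeft_tmul [PartialOrder A] (f : A →ₚ[ℂ] ℂ) (a : A) (b : B) :
    sliceLeft f (a ⊗ₜ b) = f a • b := rfl

variable [PartialOrder A] [StarOrderedRing A] [PartialOrder B] [StarOrderedRing B]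

theorem norm_add_norm_le (h : CStarTensor A B T) [Nontrivial A] [Nontrivial B] {a : A} {b : B}
    (ha : 0 ≤ a) (hb : 0 ≤ b) : ‖a‖ + ‖b‖ ≤ ‖h.tmul a 1 + h.tmul 1 b‖ := by
  refine le_of_forall_pos_le_add fun ε hε => ?_
  obtain ⟨p, hp, hpa⟩ := exists_ne_zero_norm_mul_sub_le ha (half_pos hε)
  obtain ⟨q, hq, hqb⟩ := exists_ne_zero_norm_mul_sub_le hb (half_pos hε)
  have hpos : 0 < ‖p‖ * ‖q‖ := mul_pos (norm_pos_iff.mpr hp) (norm_pos_iff.mpr hq)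
  have e : ((‖a‖ + ‖b‖ : ℝ) : ℂ) • h.tmul p q = (h.tmul a 1 + h.tmul 1 b) * h.tmul p q
      - h.tmul (a * p - (‖a‖ : ℂ) • p) q - h.tmul p (b * q - (‖b‖ : ℂ) • q) := by
    rw [add_mul, h.mul_tmul, h.mul_tmul, one_mul, one_mul]
    simp only [← tmulₗ_apply, map_sub, map_smul, LinearMap.sub_apply, LinearMap.smul_apply]
    push_cast
    module
  have h1 : (‖a‖ + ‖b‖) * (‖p‖ * ‖q‖) ≤ ‖h.tmul a 1 + h.tmul 1 b‖ * (‖p‖ * ‖q‖)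
      + ε / 2 * ‖p‖ * ‖q‖ + ‖p‖ * (ε / 2 * ‖q‖) := by
    calc (‖a‖ + ‖b‖) * (‖p‖ * ‖q‖) = ‖((‖a‖ + ‖b‖ : ℝ) : ℂ) • h.tmul p q‖ := by
          rw [norm_smul, h.norm_tmul, Complex.norm_real, Real.norm_of_nonneg (by positivity)]
      _ ≤ _ := by
          rw [e]
          refine (norm_sub_le _ _).trans
            (add_le_add ((norm_sub_le _ _).trans (add_le_add ?_ ?_)) ?_)
          · exact (norm_mul_le _ _).trans (by rw [h.norm_tmul])
          · rw [h.norm_tmul]; gcongr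
          · rw [h.norm_tmul]; gcongr
  refine le_of_mul_le_mul_right ?_ hpos
  linarith

theorem norm_add_le_norm_tmul_add (h : CStarTensor A B T) (hu : h.tmul 1 1 = 1)
    {f : A →ₚ[ℂ] ℂ} {g : B →ₚ[ℂ] ℂ} (hf : f 1 = 1) (hg : g 1 = 1) (a : A) (b : B) :
    ‖f a + g b‖ ≤ ‖h.tmul a 1 + h.tmul 1 b‖ := by
  have : Nontrivial A := ⟨1, 0, fun h0 => by simp [h0] at hf⟩
  have : Nontrivial B := ⟨1, 0, fun h0 => by simp [h0] at hg⟩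
  have hT : ‖(1 : T)‖ = 1 := by rw [← hu, h.norm_tmul]; simp
  have selfAdj : ∀ (a : A) (b : B), IsSelfAdjoint a → IsSelfAdjoint b →
      (f a + g b).re ≤ ‖h.tmul a 1 + h.tmul 1 b‖ := by
    intro a b ha hb
    have ha' : 0 ≤ a + algebraMap ℝ A ‖a‖ := by
      have := ha.neg_algebraMap_norm_le_self
      exact neg_le_iff_add_nonneg.mp this
    have hb' : 0 ≤ b + algebraMap ℝ B ‖b‖ := by
      have := hb.neg_algebraMap_norm_le_self
      exact neg_le_iff_add_nonneg.mp this
    have e1 : algebraMap ℝ A ‖a‖ = (‖a‖ : ℂ) • (1 : A) := by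
      rw [Algebra.algebraMap_eq_smul_one, Complex.coe_smul]
    have e2 : algebraMap ℝ B ‖b‖ = (‖b‖ : ℂ) • (1 : B) := by
      rw [Algebra.algebraMap_eq_smul_one, Complex.coe_smul]
    have key := h.norm_add_norm_le ha' hb'
    have fa := (Complex.re_le_norm _).trans (f.norm_apply_le_map_one (a + algebraMap ℝ A ‖a‖))
    have gb := (Complex.re_le_norm _).trans (g.norm_apply_le_map_one (b + algebraMap ℝ B ‖b‖))
    rw [e1] at key fa
    rw [e2] at key gb
    rw [map_add, map_smul, hf] at fa
    rw [map_add, map_smul, hg] at gb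
    have e3 : h.tmul (a + (‖a‖ : ℂ) • (1 : A)) 1 + h.tmul 1 (b + (‖b‖ : ℂ) • (1 : B))
        = (h.tmul a 1 + h.tmul 1 b) + ((‖a‖ + ‖b‖ : ℝ) : ℂ) • (1 : T) := by
      rw [h.add_left, h.add_right, h.smul_left, h.smul_right, hu]
      push_cast
      module
    rw [e3] at key
    have := key.trans (norm_add_le _ _)
    rw [norm_smul, hT, Complex.norm_real, Real.norm_of_nonneg (by positivity)] at this
    simp only [smul_eq_mul, mul_one, Complex.one_re, one_mul, Complex.add_re,
      Complex.ofReal_re] at this fa gb ⊢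
    linarith
  have re_le : ∀ (a : A) (b : B), (f a + g b).re ≤ ‖h.tmul a 1 + h.tmul 1 b‖ := by
    intro a b
    have := selfAdj ((1 / 2 : ℂ) • (a + star a)) ((1 / 2 : ℂ) • (b + star b))
      (by simp [IsSelfAdjoint, add_comm]) (by simp [IsSelfAdjoint, add_comm])
    have e1 : h.tmul ((1 / 2 : ℂ) • (a + star a)) 1 + h.tmul 1 ((1 / 2 : ℂ) • (b + star b))
        = (1 / 2 : ℂ) • ((h.tmul a 1 + h.tmul 1 b) + star (h.tmul a 1 + h.tmul 1 b)) := by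
      rw [h.smul_left, h.smul_right, h.add_left, h.add_right, star_add, h.star_tmul, h.star_tmul,
        star_one, star_one]
      module
    have e2 : f ((1 / 2 : ℂ) • (a + star a)) + g ((1 / 2 : ℂ) • (b + star b))
        = (1 / 2 : ℂ) * ((f a + g b) + star (f a + g b)) := by
      rw [map_smul, map_smul, map_add, map_add, map_star, map_star, star_add, smul_eq_mul,
        smul_eq_mul]
      ring
    have e3 : ((1 / 2 : ℂ) * ((f a + g b) + star (f a + g b))).re = (f a + g b).re := by
      rw [Complex.star_def, Complex.add_conj]
      have : (1 / 2 : ℂ) * ((2 * (f a + g b).re : ℝ) : ℂ) = ((f a + g b).re : ℂ) := by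
        push_cast; ring
      rw [this, Complex.ofReal_re]
    rw [e1, e2, e3, norm_smul] at this
    have h2 := norm_add_le (h.tmul a 1 + h.tmul 1 b) (star (h.tmul a 1 + h.tmul 1 b))
    rw [norm_star] at h2
    have h3 : ‖(1 / 2 : ℂ)‖ = 1 / 2 := by norm_num
    rw [h3] at this
    linarith
  rcases eq_or_ne (f a + g b) 0 with h0 | h0
  · rw [h0, norm_zero]; exact norm_nonneg _
  let c : ℂ := star (f a + g b) / ‖f a + g b‖
  have hn : (‖f a + g b‖ : ℂ) ≠ 0 := by simpa using h0
  have hc : c * (f a + g b) = ‖f a + g b‖ := by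
    rw [div_mul_eq_mul_div, Complex.star_def, ← Complex.normSq_eq_conj_mul_self,
      Complex.normSq_eq_norm_sq]
    field_simp
    push_cast; ring
  have hc1 : ‖c‖ = 1 := by
    rw [norm_div, norm_star, Complex.norm_real, norm_norm, div_self (norm_ne_zero_iff.mpr h0)]
  have := re_le (c • a) (c • b)
  rw [map_smul, map_smul, ← smul_add, smul_eq_mul, hc, h.smul_left, h.smul_right, ← smul_add,
    norm_smul, hc1, one_mul, Complex.ofReal_re] at this
  exact this

variable [PartialOrder T] [StarOrderedRing T]

theorem tmul_nonneg (h : CStarTensor A B T) {a : A} {b : B} (ha : 0 ≤ a) (hb : 0 ≤ b) :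
    0 ≤ h.tmul a b := by
  obtain ⟨s, rfl⟩ := CStarAlgebra.nonneg_iff_eq_star_mul_self.mp ha
  obtain ⟨r, rfl⟩ := CStarAlgebra.nonneg_iff_eq_star_mul_self.mp hb
  rw [← h.mul_tmul, ← h.star_tmul]
  exact star_mul_self_nonneg _

theorem exists_state_extending (h : CStarTensor A B T) (hu : h.tmul 1 1 = 1)
    {f : A →ₚ[ℂ] ℂ} {g : B →ₚ[ℂ] ℂ} (hf : f 1 = 1) (hg : g 1 = 1) :
    ∃ ω : T →ₚ[ℂ] ℂ, (∀ a, ω (h.tmul a 1) = f a) ∧ ∀ b, ω (h.tmul 1 b) = g b := by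
  obtain ⟨ρ, hρ, hl⟩ := exists_strongDual_comp_eq
    ((h.tmulₗ.flip 1).coprod (h.tmulₗ 1)) (f.toLinearMap.coprod g.toLinearMap)
    fun z => h.norm_add_le_norm_tmul_add hu hf hg z.1 z.2
  have hA : ∀ a, ρ (h.tmul a 1) = f a := fun a => by simpa using hl (a, 0)
  have hB : ∀ b, ρ (h.tmul 1 b) = g b := fun b => by simpa using hl (0, b)
  obtain ⟨ω, hω⟩ := exists_positiveLinearMap_of_norm_le_one ρ hρ (by rw [← hu, hA, hf])
  exact ⟨ω, fun a => by rw [hω, hA], fun b => by rw [hω, hB]⟩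

/-- The slice of a positive functional on the tensor product at a positive element. -/
def slice (h : CStarTensor A B T) (ω : T →ₚ[ℂ] ℂ) {a : A} (ha : 0 ≤ a) : B →ₚ[ℂ] ℂ :=
  .mk₀ (ω.toLinearMap ∘ₗ h.tmulₗ a) fun _ hb => ω.map_nonneg (h.tmul_nonneg ha hb)

theorem apply_tmul_eq_mul_of_extreme (h : CStarTensor A B T) (ω : T →ₚ[ℂ] ℂ) {g : WeakDual ℂ B}
    (hg : g ∈ (stateSpace B).extremePoints ℝ) (hω : ∀ b, ω (h.tmul 1 b) = g b) (a : A) (b : B) :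
    ω (h.tmul a b) = ω (h.tmul a 1) * g b := by
  have ha : a ∈ Submodule.span ℂ ({x : A | 0 ≤ x} ∩ Metric.closedBall 0 1) := by
    rw [CStarAlgebra.span_nonneg_inter_unitClosedBall]; trivial
  induction ha using Submodule.span_induction with
  | mem a ha =>
    have ha1 : 0 ≤ 1 - a := sub_nonneg.mpr
      ((CStarAlgebra.norm_le_one_iff_of_nonneg a ha.1).mp (by simpa using ha.2))
    refine apply_eq_mul_of_le_extreme hg (h.slice ω ha.1) (h.slice ω ha1) (fun b => ?_) b
    change ω (h.tmulₗ a b) + ω (h.tmulₗ (1 - a) b) = g b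
    rw [← hω, ← map_add, ← LinearMap.add_apply, ← map_add, add_sub_cancel, tmulₗ_apply]
  | zero => simp
  | add x y _ _ hx hy => rw [h.add_left, h.add_left, map_add, map_add, hx, hy, add_mul]
  | smul c x _ hx =>
    rw [h.smul_left, h.smul_left, map_smul, map_smul, hx, smul_eq_mul, smul_eq_mul, mul_assoc]

theorem norm_apply_sliceLeft_le_of_extreme (h : CStarTensor A B T) (hu : h.tmul 1 1 = 1)
    {f : A →ₚ[ℂ] ℂ} (hf : f 1 = 1) {g : WeakDual ℂ B}
    (hg : g ∈ (stateSpace B).extremePoints ℝ) (z : A ⊗[ℂ] B) :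
    ‖g (sliceLeft f z)‖ ≤ ‖h.lift z‖ := by
  obtain ⟨k, hk1, hk⟩ := hg.1
  obtain ⟨ω, hωA, hωB⟩ := h.exists_state_extending hu hf hk1
  have e : g (sliceLeft f z) = ω (h.lift z) := by
    induction z using TensorProduct.induction_on with
    | zero => rw [map_zero, map_zero, map_zero, map_zero]
    | tmul a b =>
      rw [sliceLeft_tmul, lift_tmul,
        h.apply_tmul_eq_mul_of_extreme ω hg (fun b => by rw [hωB, hk]), hωA]
      exact map_smul g (f a) b
    | add x y hx hy => rw [map_add, map_add, map_add, map_add, hx, hy]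
  have hω1 : ω 1 = 1 := by rw [← hu, hωA, hf]
  have := ω.norm_apply_le_map_one (h.lift z)
  rw [hω1, Complex.one_re, one_mul] at this
  rwa [e]

theorem norm_apply_sliceLeft_le (h : CStarTensor A B T) (hu : h.tmul 1 1 = 1)
    {f : A →ₚ[ℂ] ℂ} (hf : f 1 = 1) {g : WeakDual ℂ B} (hg : g ∈ stateSpace B) (z : A ⊗[ℂ] B) :
    ‖g (sliceLeft f z)‖ ≤ ‖h.lift z‖ :=
  norm_apply_le_of_extreme (fun _ hg => h.norm_apply_sliceLeft_le_of_extreme hu hf hg z) hg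

/-- Product states are continuous for every C*-norm. -/
theorem exists_apply_tmul_eq_mul_of_state (h : CStarTensor A B T) (hu : h.tmul 1 1 = 1)
    {f : A →ₚ[ℂ] ℂ} {g : B →ₚ[ℂ] ℂ} (hf : f 1 = 1) (hg : g 1 = 1) :
    ∃ ω : T →ₚ[ℂ] ℂ, ∀ a b, ω (h.tmul a b) = f a * g b := by
  obtain ⟨g', hg', hgg⟩ := g.exists_mem_stateSpace hg
  obtain ⟨ρ, hρ, hl⟩ := exists_strongDual_comp_eq h.lift (g.toLinearMap ∘ₗ sliceLeft f) fun z =>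
    (congrArg norm (hgg _)).symm.le.trans (h.norm_apply_sliceLeft_le hu hf hg' z)
  have hab : ∀ a b, ρ (h.tmul a b) = f a * g b := fun a b =>
    (hl (a ⊗ₜ b)).trans (map_smul g (f a) b)
  obtain ⟨ω, hω⟩ := exists_positiveLinearMap_of_norm_le_one ρ hρ
    (by rw [← hu, hab, hf, hg, one_mul])
  exact ⟨ω, fun a b => by rw [hω, hab]⟩

theorem exists_apply_tmul_eq_mul (h : CStarTensor A B T) (hu : h.tmul 1 1 = 1)
    (f : A →ₚ[ℂ] ℂ) (g : B →ₚ[ℂ] ℂ) :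
    ∃ ω : T →ₚ[ℂ] ℂ, ∀ a b, ω (h.tmul a b) = f a * g b := by
  rcases f.eq_zero_or_exists_state with h0 | ⟨f', hf1, hf⟩
  · exact ⟨0, fun a b => by simp [h0]⟩
  rcases g.eq_zero_or_exists_state with h0 | ⟨g', hg1, hg⟩
  · exact ⟨0, fun a b => by simp [h0]⟩
  obtain ⟨ω, hω⟩ := h.exists_apply_tmul_eq_mul_of_state hu hf1 hg1
  refine ⟨.mk₀ ((f 1 * g 1) • ω.toLinearMap) fun x hx => ?_, fun a b => ?_⟩
  · exact mul_nonneg (mul_nonneg (f.map_nonneg zero_le_one) (g.map_nonneg zero_le_one))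
      (ω.map_nonneg hx)
  · change f 1 * g 1 * ω (h.tmul a b) = f a * g b
    rw [hω, hf a, hg b]
    ring

end CStarTensor

section Subalgebra

variable {A B C : Type u} [NonUnitalCStarAlgebra A] [NonUnitalCStarAlgebra B]
  [NonUnitalCStarAlgebra C]

/-- The star subalgebra spanned by the elementary tensors of a multiplicative, star-preserving
bilinear map. -/
def spanStarSubalgebra (m : A →ₗ[ℂ] B →ₗ[ℂ] C)
    (hmul : ∀ a a' b b', m a b * m a' b' = m (a * a') (b * b'))
    (hstar : ∀ a b, star (m a b) = m (star a) (star b)) : NonUnitalStarSubalgebra ℂ C where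
  __ := Submodule.span ℂ {c | ∃ a b, m a b = c}
  mul_mem' {x y} hx hy := by
    induction hx, hy using Submodule.span_induction₂ with
    | mem_mem x y hx hy =>
      obtain ⟨a, b, rfl⟩ := hx
      obtain ⟨a', b', rfl⟩ := hy
      exact Submodule.subset_span ⟨_, _, (hmul a a' b b').symm⟩
    | zero_left y _ => rw [zero_mul]; exact Submodule.zero_mem _
    | zero_right x _ => rw [mul_zero]; exact Submodule.zero_mem _
    | add_left x y z _ _ _ hx hy => rw [add_mul]; exact Submodule.add_mem _ hx hy
    | add_right x y z _ _ _ hx hy => rw [mul_add]; exact Submodule.add_mem _ hx hy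
    | smul_left c x y _ _ h => rw [smul_mul_assoc]; exact Submodule.smul_mem _ _ h
    | smul_right c x y _ _ h => rw [mul_smul_comm]; exact Submodule.smul_mem _ _ h
  star_mem' {x} hx := by
    induction hx using Submodule.span_induction with
    | mem x hx =>
      obtain ⟨a, b, rfl⟩ := hx
      exact Submodule.subset_span ⟨_, _, (hstar a b).symm⟩
    | zero => rw [star_zero]; exact Submodule.zero_mem _
    | add x y _ _ hx hy => rw [star_add]; exact Submodule.add_mem _ hx hy
    | smul c x _ h => rw [star_smul]; exact Submodule.smul_mem _ _ h

theorem MinTensor.exists_hom_subalgebra {T : Type u} [NonUnitalCStarAlgebra T]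
    (h : MinTensor A B T) (m : A →ₗ[ℂ] B →ₗ[ℂ] C)
    (hmul : ∀ a a' b b', m a b * m a' b' = m (a * a') (b * b'))
    (hstar : ∀ a b, star (m a b) = m (star a) (star b))
    (hnorm : ∀ a b, ‖m a b‖ = ‖a‖ * ‖b‖) :
    ∃ (S : NonUnitalStarSubalgebra ℂ C) (_ : IsClosed (S : Set C)) (hm : ∀ a b, m a b ∈ S)
      (π : S →⋆ₙₐ[ℂ] T),
      Dense ((Submodule.span ℂ {s : S | ∃ a b, ⟨m a b, hm a b⟩ = s} : Submodule ℂ S) : Set S) ∧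
      (∀ a b, π ⟨m a b, hm a b⟩ = h.tmul a b) ∧ Continuous π := by
  let S₀ := spanStarSubalgebra m hmul hstar
  let S := S₀.topologicalClosure
  have hS : IsClosed (S : Set C) := S₀.isClosed_topologicalClosure
  have hm : ∀ a b, m a b ∈ S := fun a b =>
    S₀.le_topologicalClosure (Submodule.subset_span ⟨a, b, rfl⟩)
  let : NonUnitalCStarAlgebra S := NonUnitalStarSubalgebra.nonUnitalCStarAlgebra S
  have hd : Dense ((Submodule.span ℂ {s : S | ∃ a b, ⟨m a b, hm a b⟩ = s} : Submodule ℂ S) :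
      Set S) := by
    rw [Topology.IsInducing.subtypeVal.dense_iff]
    intro x
    have hx : (x : C) ∈ closure (S₀ : Set C) := x.2
    refine closure_mono ?_ hx
    intro y (hy : y ∈ Submodule.span ℂ {c | ∃ a b, m a b = c})
    induction hy using Submodule.span_induction with
    | mem y hy =>
      obtain ⟨a, b, rfl⟩ := hy
      exact ⟨⟨m a b, hm a b⟩, Submodule.subset_span ⟨a, b, rfl⟩, rfl⟩
    | zero => exact ⟨0, Submodule.zero_mem _, rfl⟩
    | add x y _ _ hx hy =>
      obtain ⟨s, hs, rfl⟩ := hx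
      obtain ⟨r, hr, rfl⟩ := hy
      exact ⟨s + r, Submodule.add_mem _ hs hr, rfl⟩
    | smul c x _ hx =>
      obtain ⟨s, hs, rfl⟩ := hx
      exact ⟨c • s, Submodule.smul_mem _ c hs, rfl⟩
  let t : CStarTensor A B S :=
    { tmul := fun a b => ⟨m a b, hm a b⟩
      add_left := fun a a' b => by ext; simp
      add_right := fun a a' b => by ext; simp
      smul_left := fun a a' b => by ext; simp
      smul_right := fun a a' b => by ext; simp
      mul_tmul := fun a a' b b' => by ext; exact hmul a a' b b'
      star_tmul := fun a b => by ext; exact hstar a b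
      norm_tmul := fun a b => hnorm a b
      dense_span := hd }
  obtain ⟨π, hπ⟩ := h.minimal S t
  exact ⟨S, hS, hm, π, hd, hπ, AddMonoidHomClass.continuous_of_bound π 1 fun s => by
    simpa using! NonUnitalStarAlgHom.norm_apply_le π s⟩

end Subalgebra

section Faithful

open scoped ComplexOrder

variable {A : Type*} [CStarAlgebra A] [PartialOrder A] [StarOrderedRing A]

variable (A) in
/-- A separable C*-algebra has a faithful positive functional. -/
theorem exists_faithful_positiveLinearMap [TopologicalSpace.SeparableSpace A] :
    ∃ f : A →ₚ[ℂ] ℂ, ∀ a, 0 ≤ a → f a = 0 → a = 0 := by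
  have : SecondCountableTopology A := UniformSpace.secondCountable_of_separable A
  have : Nonempty {a : A // 0 ≤ a} := ⟨⟨0, le_rfl⟩⟩
  obtain ⟨p, hp⟩ := TopologicalSpace.exists_dense_seq {a : A // 0 ≤ a}
  have hs : ∀ n, ∃ f : A →ₚ[ℂ] ℂ, (∀ a, ‖f a‖ ≤ ‖a‖) ∧ f (p n : A) = ‖(p n : A)‖ := by
    intro n
    by_cases h0 : (p n : A) = 0
    · exact ⟨0, fun a => by simp, by simp [h0]⟩
    · obtain ⟨f, hf1, hf⟩ := exists_state_apply_ne_zero (p n).2 h0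
      exact ⟨f, fun a => by simpa [hf1] using f.norm_apply_le_map_one a, hf⟩
  choose f hf hfp using hs
  have hsum : ∀ a, Summable fun n => ((1 / 2 : ℝ) ^ n : ℂ) * f n a := fun a => by
    refine Summable.of_norm_bounded (g := fun n => (1 / 2 : ℝ) ^ n * ‖a‖)
      (summable_geometric_two.mul_right _) fun n => ?_
    rw [norm_mul, norm_pow, Complex.norm_real, Real.norm_of_nonneg (by norm_num)]
    gcongr
    exact hf n a
  have hpos : ∀ a, 0 ≤ a → ∀ n, 0 ≤ ((1 / 2 : ℝ) ^ n : ℂ) * f n a := fun a ha n =>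
    mul_nonneg (by exact_mod_cast pow_nonneg (by norm_num : (0 : ℝ) ≤ 1 / 2) n)
      ((f n).map_nonneg ha)
  let F : A →ₗ[ℂ] ℂ :=
    { toFun := fun a => ∑' n, ((1 / 2 : ℝ) ^ n : ℂ) * f n a
      map_add' := fun a b => by
        rw [← (hsum a).tsum_add (hsum b)]
        simp only [map_add, mul_add]
      map_smul' := fun c a => by
        rw [RingHom.id_apply, smul_eq_mul, ← tsum_mul_left]
        simp only [map_smul, smul_eq_mul, mul_left_comm] }
  refine ⟨.mk₀ F fun a ha => tsum_nonneg (hpos a ha), fun a ha h0 => ?_⟩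
  have hz : ∀ n, f n a = 0 := fun n => by
    have h0 : ∑' n, ((1 / 2 : ℝ) ^ n : ℂ) * f n a = 0 := h0
    have h1 := (hasSum_zero_iff_of_nonneg (hpos a ha)).mp (h0 ▸ (hsum a).hasSum)
    have h2 := congrFun h1 n
    simpa using h2
  refine norm_le_zero_iff.mp (le_of_forall_pos_le_add fun ε hε => ?_)
  obtain ⟨n, hn⟩ := hp.exists_dist_lt ⟨a, ha⟩ (half_pos hε)
  have hn : ‖a - p n‖ < ε / 2 := by simpa [Subtype.dist_eq, dist_eq_norm] using hn
  have h1 : ‖(p n : A)‖ ≤ ‖a - p n‖ := by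
    have := hf n (a - p n)
    rw [map_sub, hz, hfp, zero_sub, norm_neg, Complex.norm_real, norm_norm] at this
    exact this
  have h2 := norm_add_le (a - p n) (p n)
  rw [sub_add_cancel] at h2
  linarith

theorem PositiveLinearMap.gnsNonUnitalStarAlgHom_apply_eq_zero_iff (f : A →ₚ[ℂ] ℂ) (a x : A) :
    f.gnsNonUnitalStarAlgHom a (f.toPreGNS x) = 0 ↔ f (star x * (star a * a) * x) = 0 := by
  have key : ‖f.leftMulMapPreGNS a (f.toPreGNS x)‖ ^ 2 = f (star x * (star a * a) * x) := by
    rw [f.preGNS_norm_sq]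
    simp [mul_assoc]
  rw [← key, f.gnsNonUnitalStarAlgHom_apply_coe, ← norm_eq_zero, UniformSpace.Completion.norm_coe]
  norm_cast
  simp

theorem PositiveLinearMap.gnsNonUnitalStarAlgHom_eq_zero_iff (f : A →ₚ[ℂ] ℂ) (a : A) :
    f.gnsNonUnitalStarAlgHom a = 0 ↔ ∀ x, f (star x * (star a * a) * x) = 0 := by
  refine ⟨fun h x => (f.gnsNonUnitalStarAlgHom_apply_eq_zero_iff a x).mp (by rw [h]; rfl),
    fun h => ?_⟩
  ext y
  induction y using UniformSpace.Completion.induction_on with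
  | hp => apply isClosed_eq <;> fun_prop
  | ih y => exact (f.gnsNonUnitalStarAlgHom_apply_eq_zero_iff a (f.ofPreGNS y)).mpr (h _)

theorem PositiveLinearMap.norm_le_norm_leftMulMapPreGNS (f : A →ₚ[ℂ] ℂ)
    (hf : ∀ a, 0 ≤ a → f a = 0 → a = 0) (a : A) : ‖a‖ ≤ ‖f.leftMulMapPreGNS a‖ := by
  have hinj : Function.Injective f.gnsNonUnitalStarAlgHom := by
    rw [injective_iff_map_eq_zero]
    intro b hb
    have h1 := hf _ (star_mul_self_nonneg b) (by
      simpa using (f.gnsNonUnitalStarAlgHom_eq_zero_iff b).mp hb 1)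
    exact CStarRing.star_mul_self_eq_zero_iff b |>.mp h1
  rw [← NonUnitalStarAlgHom.norm_map f.gnsNonUnitalStarAlgHom hinj a,
    f.gnsNonUnitalStarAlgHom_apply]
  refine ContinuousLinearMap.opNorm_le_bound _ (f.leftMulMapPreGNS a).opNorm_nonneg fun x => ?_
  induction x using UniformSpace.Completion.induction_on with
  | hp => apply isClosed_le <;> fun_prop
  | ih x => simpa using (f.leftMulMapPreGNS a).le_opNorm x

end Faithful

theorem ContinuousLinearMap.opNorm_mul_opNorm_le {E F : Type*} [SeminormedAddCommGroup E]
    [NormedSpace ℂ E] [SeminormedAddCommGroup F] [NormedSpace ℂ F] (P : E →L[ℂ] E) (Q : F →L[ℂ] F)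
    {M : ℝ} (hM : 0 ≤ M) (h : ∀ x y, ‖P x‖ * ‖Q y‖ ≤ M * (‖x‖ * ‖y‖)) : ‖P‖ * ‖Q‖ ≤ M := by
  have h1 : ∀ y, ‖P‖ * ‖Q y‖ ≤ M * ‖y‖ := by
    intro y
    rcases (norm_nonneg (Q y)).eq_or_lt with h0 | h0
    · rw [← h0, mul_zero]; positivity
    · rw [← le_div_iff₀ h0]
      refine P.opNorm_le_bound (by positivity) fun x => ?_
      rw [div_mul_eq_mul_div, le_div_iff₀ h0]
      linarith [h x y]
  rcases (norm_nonneg P).eq_or_lt with h0 | h0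
  · rw [← h0, zero_mul]; exact hM
  · rw [mul_comm, ← le_div_iff₀ h0]
    refine Q.opNorm_le_bound (by positivity) fun y => ?_
    rw [div_mul_eq_mul_div, le_div_iff₀ h0]
    linarith [h1 y]

theorem Dense.span_induction {M : Type*} [AddCommMonoid M] [Module ℂ M] [TopologicalSpace M]
    {s : Set M} (hs : Dense (Submodule.span ℂ s : Set M)) {p : M → Prop}
    (closed : IsClosed {x | p x})
    (mem : ∀ x ∈ s, p x) (zero : p 0) (add : ∀ x y, p x → p y → p (x + y))
    (smul : ∀ (c : ℂ) x, p x → p (c • x)) (x : M) : p x := by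
  refine closure_minimal (fun y hy => ?_) closed (hs x)
  induction hy using Submodule.span_induction with
  | mem y hy => exact mem y hy
  | zero => exact zero
  | add x y _ _ hx hy => exact add x y hx hy
  | smul c x _ hx => exact smul c x hx

theorem CStarTensor.induction_on {A : Type u} {B : Type v} {T : Type w} [NonUnitalCStarAlgebra A]
    [NonUnitalCStarAlgebra B] [NonUnitalCStarAlgebra T] (h : CStarTensor A B T) {p : T → Prop}
    (closed : IsClosed {t | p t}) (tmul : ∀ a b, p (h.tmul a b))
    (add : ∀ s t, p s → p t → p (s + t)) (smul : ∀ (c : ℂ) t, p t → p (c • t)) (t : T) : p t :=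
  h.dense_span.span_induction closed (by rintro _ ⟨a, b, rfl⟩; exact tmul a b)
    (by simpa using smul 0 _ (tmul 0 0)) add smul t

/-- A homomorphism out of the minimal tensor product is injective as soon as it is isometric on
elementary tensors. -/
theorem MinTensor.injective_of_le_norm_map_tmul {A B C T : Type u} [NonUnitalCStarAlgebra A]
    [NonUnitalCStarAlgebra B] [NonUnitalCStarAlgebra C] [NonUnitalCStarAlgebra T]
    (h : MinTensor A B T) (P : T →⋆ₙₐ[ℂ] C)
    (hP : ∀ a b, ‖a‖ * ‖b‖ ≤ ‖P (h.tmul a b)‖) : Function.Injective P := by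
  have hcont : Continuous P :=
    AddMonoidHomClass.continuous_of_bound P 1 fun s => by
      simpa using NonUnitalStarAlgHom.norm_apply_le P s
  let m : A →ₗ[ℂ] B →ₗ[ℂ] C :=
    LinearMap.mk₂ ℂ (fun a b => P (h.tmul a b))
      (fun a a' b => by rw [h.add_left, map_add]) (fun c a b => by rw [h.smul_left, map_smul])
      (fun a b b' => by rw [h.add_right, map_add]) (fun c a b => by rw [h.smul_right, map_smul])
  obtain ⟨S, hS, hm, π, -, hπ, hπc⟩ := h.exists_hom_subalgebra m
    (fun a a' b b' => by
      change P _ * P _ = P _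
      rw [← map_mul, h.mul_tmul])
    (fun a b => by
      change star (P _) = P _
      rw [← map_star, h.star_tmul])
    (fun a b => le_antisymm
      ((NonUnitalStarAlgHom.norm_apply_le P _).trans (h.norm_tmul a b).le)
      (hP a b))
  have hmem : ∀ t, P t ∈ S := h.induction_on (hS.preimage hcont) hm
    (fun s t hs ht => by rw [map_add]; exact add_mem hs ht)
    (fun c t ht => by rw [map_smul]; exact SMulMemClass.smul_mem c ht)
  have hleft : ∀ t, π ⟨P t, hmem t⟩ = t := h.induction_on
    (isClosed_eq (hπc.comp (hcont.subtype_mk hmem)) continuous_id) hπ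
    (fun s t hs ht => by
      have : (⟨P (s + t), hmem _⟩ : S) = ⟨P s, hmem s⟩ + ⟨P t, hmem t⟩ :=
        Subtype.ext (map_add P s t)
      rw [this, map_add, hs, ht])
    (fun c t ht => by
      have : (⟨P (c • t), hmem _⟩ : S) = c • (⟨P t, hmem t⟩ : S) := Subtype.ext (map_smul P c t)
      rw [this, map_smul, ht])
  intro s t hst
  rw [← hleft s, ← hleft t]
  congr 2

section ProductFunctional

open scoped ComplexOrder

variable {A B T : Type u} [CStarAlgebra A] [CStarAlgebra B] [CStarAlgebra T]
  [PartialOrder A] [StarOrderedRing A] [PartialOrder B] [StarOrderedRing B]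
  [PartialOrder T] [StarOrderedRing T]

theorem CStarTensor.norm_le_norm_gns_tmul (h : CStarTensor A B T) {f : A →ₚ[ℂ] ℂ}
    {g : B →ₚ[ℂ] ℂ} (hf : ∀ a, 0 ≤ a → f a = 0 → a = 0) (hg : ∀ b, 0 ≤ b → g b = 0 → b = 0)
    {ω : T →ₚ[ℂ] ℂ} (hω : ∀ a b, ω (h.tmul a b) = f a * g b) (a : A) (b : B) :
    ‖a‖ * ‖b‖ ≤ ‖ω.gnsNonUnitalStarAlgHom (h.tmul a b)‖ := by
  have hpre : ∀ x y, ‖ω.toPreGNS (h.tmul x y)‖ = ‖f.toPreGNS x‖ * ‖g.toPreGNS y‖ := by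
    intro x y
    rw [← sq_eq_sq₀ (norm_nonneg _) (by positivity), mul_pow]
    have : ((‖ω.toPreGNS (h.tmul x y)‖ ^ 2 : ℝ) : ℂ)
        = (‖f.toPreGNS x‖ ^ 2 * ‖g.toPreGNS y‖ ^ 2 : ℝ) := by
      push_cast
      rw [f.preGNS_norm_sq, g.preGNS_norm_sq, ω.preGNS_norm_sq]
      simp only [PositiveLinearMap.ofPreGNS_toPreGNS]
      rw [h.star_tmul, h.mul_tmul, hω]
    exact_mod_cast this
  refine le_trans (mul_le_mul (f.norm_le_norm_leftMulMapPreGNS hf a)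
    (g.norm_le_norm_leftMulMapPreGNS hg b) (norm_nonneg _) (ContinuousLinearMap.opNorm_nonneg _)) ?_
  refine ContinuousLinearMap.opNorm_mul_opNorm_le _ _ (norm_nonneg _) fun x y => ?_
  have := (ω.gnsNonUnitalStarAlgHom (h.tmul a b)).le_opNorm
    (ω.toPreGNS (h.tmul (f.ofPreGNS x) (g.ofPreGNS y)))
  rw [ω.gnsNonUnitalStarAlgHom_apply_coe, UniformSpace.Completion.norm_coe,
    UniformSpace.Completion.norm_coe, hpre, ω.leftMulMapPreGNS_apply, ω.ofPreGNS_toPreGNS,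
    h.mul_tmul, hpre] at this
  exact this

/-- The GNS representation of a product of faithful functionals is faithful on the minimal tensor
product. -/
theorem MinTensor.gnsNonUnitalStarAlgHom_injective (h : MinTensor A B T) {f : A →ₚ[ℂ] ℂ}
    {g : B →ₚ[ℂ] ℂ} (hf : ∀ a, 0 ≤ a → f a = 0 → a = 0) (hg : ∀ b, 0 ≤ b → g b = 0 → b = 0)
    {ω : T →ₚ[ℂ] ℂ} (hω : ∀ a b, ω (h.tmul a b) = f a * g b) :
    Function.Injective ω.gnsNonUnitalStarAlgHom :=
  h.injective_of_le_norm_map_tmul ω.gnsNonUnitalStarAlgHom (h.norm_le_norm_gns_tmul hf hg hω)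

theorem MinTensor.eq_zero_of_forall_apply_eq_zero (h : MinTensor A B T) {f : A →ₚ[ℂ] ℂ}
    {g : B →ₚ[ℂ] ℂ} (hf : ∀ a, 0 ≤ a → f a = 0 → a = 0) (hg : ∀ b, 0 ≤ b → g b = 0 → b = 0)
    {ω : T →ₚ[ℂ] ℂ} (hω : ∀ a b, ω (h.tmul a b) = f a * g b) {t : T}
    (ht : ∀ x y, ω (star (h.tmul x y) * (star t * t) * h.tmul x y) = 0) : t = 0 := by
  refine (injective_iff_map_eq_zero _).mp (h.gnsNonUnitalStarAlgHom_injective hf hg hω) t ?_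
  rw [ω.gnsNonUnitalStarAlgHom_eq_zero_iff]
  have hω' : Continuous ω := map_continuous ω
  have hclosed : IsClosed {x : T | ω (star x * (star t * t) * x) = 0} :=
    isClosed_eq (by fun_prop) continuous_const
  simp only [← ω.gnsNonUnitalStarAlgHom_apply_eq_zero_iff] at ht hclosed ⊢
  refine h.induction_on hclosed ht (fun x y hx hy => ?_) (fun c x hx => ?_)
  · rw [map_add, UniformSpace.Completion.coe_add, map_add, hx, hy, add_zero]
  · rw [map_smul, UniformSpace.Completion.coe_smul, map_smul, hx, smul_zero]

end ProductFunctional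

section TensorMap

open scoped ComplexOrder

variable {A B T : Type u} [CStarAlgebra A] [CStarAlgebra B] [CStarAlgebra T]

/-- The positive functional `a ↦ f (x* (α a) x)`. -/
def PositiveLinearMap.conjComp [PartialOrder A] [StarOrderedRing A] [PartialOrder B]
    [StarOrderedRing B] (f : B →ₚ[ℂ] ℂ) (x : B) (α : A →⋆ₐ[ℂ] B) : A →ₚ[ℂ] ℂ :=
  .mk₀ (f.toLinearMap ∘ₗ LinearMap.mulRight ℂ x ∘ₗ LinearMap.mulLeft ℂ (star x) ∘ₗ
    α.toAlgHom.toLinearMap) fun a ha => by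
    obtain ⟨s, rfl⟩ := CStarAlgebra.nonneg_iff_eq_star_mul_self.mp ha
    refine f.map_nonneg (star_left_conjugate_nonneg ?_ x)
    change 0 ≤ α (star s * s)
    rw [map_mul, map_star]
    exact star_mul_self_nonneg _

theorem PositiveLinearMap.conjComp_apply [PartialOrder A] [StarOrderedRing A] [PartialOrder B]
    [StarOrderedRing B] (f : B →ₚ[ℂ] ℂ) (x : B) (α : A →⋆ₐ[ℂ] B) (a : A) :
    f.conjComp x α a = f (star x * α a * x) := rfl

/-- The minimal tensor product is functorial for injective endomorphisms of the second factor. -/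
theorem MinTensor.exists_map_right [TopologicalSpace.SeparableSpace A]
    [TopologicalSpace.SeparableSpace B] (h : MinTensor A B T) (hu : h.tmul 1 1 = 1)
    (α : B →⋆ₐ[ℂ] B) (hα : Function.Injective α) :
    ∃ Φ : T →⋆ₐ[ℂ] T, ∀ a b, Φ (h.tmul a b) = h.tmul a (α b) := by
  let := CStarAlgebra.spectralOrder A
  have := CStarAlgebra.spectralOrderedRing A
  let := CStarAlgebra.spectralOrder B
  have := CStarAlgebra.spectralOrderedRing B
  let := CStarAlgebra.spectralOrder T
  have := CStarAlgebra.spectralOrderedRing T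
  obtain ⟨f, hf⟩ := exists_faithful_positiveLinearMap A
  obtain ⟨g, hg⟩ := exists_faithful_positiveLinearMap B
  obtain ⟨ω, hω⟩ := h.exists_apply_tmul_eq_mul hu f g
  obtain ⟨S, hS, hm, π, hd, hπ, hπc⟩ := h.exists_hom_subalgebra
    (h.tmulₗ.compl₂ α.toAlgHom.toLinearMap)
    (fun a a' b b' => by
      change h.tmul _ (α _) * h.tmul _ (α _) = h.tmul _ (α _)
      rw [h.mul_tmul, map_mul])
    (fun a b => by
      change star (h.tmul _ (α _)) = h.tmul _ (α _)
      rw [h.star_tmul, map_star])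
    (fun a b => by
      change ‖h.tmul _ (α _)‖ = _
      rw [h.norm_tmul, NonUnitalStarAlgHom.norm_map α hα])
  have hinj : Function.Injective π := by
    rw [injective_iff_map_eq_zero]
    intro t ht
    refine Subtype.ext (h.eq_zero_of_forall_apply_eq_zero hf hg hω fun x y => ?_)
    obtain ⟨Ω, hΩ⟩ := h.exists_apply_tmul_eq_mul hu (f.conjComp x (.id ℂ A)) (g.conjComp y α)
    have hωc : Continuous ω := map_continuous ω
    have hΩc : Continuous Ω := map_continuous Ω
    have key : ∀ s : S, ω (star (h.tmul x y) * s * h.tmul x y) = Ω (π s) := by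
      refine hd.span_induction (isClosed_eq (by fun_prop) (by fun_prop)) ?_ (by simp) ?_ ?_
      · rintro _ ⟨a, b, rfl⟩
        rw [hπ, hΩ, f.conjComp_apply, g.conjComp_apply]
        change ω (_ * h.tmul a (α b) * _) = _
        rw [h.star_tmul, h.mul_tmul, h.mul_tmul, hω]
        rfl
      · intro s t hs ht
        rw [map_add, map_add, ← hs, ← ht, ← map_add]
        simp [mul_add, add_mul]
      · intro c s hs
        rw [map_smul, map_smul, ← hs, ← map_smul]
        simp
    have := key (star t * t)
    rw [map_mul π, ht, mul_zero, map_zero] at this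
    exact this
  let : NonUnitalCStarAlgebra S := NonUnitalStarSubalgebra.nonUnitalCStarAlgebra S
  have hiso : Isometry π := NonUnitalStarAlgHom.isometry π hinj
  have hsurj : Function.Surjective π := h.induction_on hiso.isClosedEmbedding.isClosed_range
    (fun a b => ⟨_, hπ a b⟩)
    (by rintro _ _ ⟨s, rfl⟩ ⟨t, rfl⟩; exact ⟨s + t, map_add _ _ _⟩)
    (by rintro c _ ⟨s, rfl⟩; exact ⟨c • s, map_smul _ _ _⟩)
  let e : S ≃⋆ₐ[ℂ] T := StarAlgEquiv.ofBijective π ⟨hinj, hsurj⟩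
  let Φ : T →⋆ₙₐ[ℂ] T := (NonUnitalStarSubalgebraClass.subtype S).comp (e.symm : T →⋆ₙₐ[ℂ] S)
  have hΦ : ∀ a b, Φ (h.tmul a b) = h.tmul a (α b) := by
    intro a b
    have : e.symm (h.tmul a b) = ⟨h.tmul a (α b), hm a b⟩ := by
      rw [← hπ]
      exact e.symm_apply_apply _
    exact congrArg Subtype.val this
  have h1 : Φ 1 = 1 := by rw [← hu, hΦ, map_one]
  exact ⟨{ Φ with
    map_one' := h1
    commutes' := fun c => by
      change Φ _ = _
      rw [Algebra.algebraMap_eq_smul_one, map_smul, h1] }, hΦ⟩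

theorem MinTensor.exists_flip (h : MinTensor A A T) (hu : h.tmul 1 1 = 1) :
    ∃ σ : T →⋆ₐ[ℂ] T, ∀ a b, σ (h.tmul a b) = h.tmul b a := by
  obtain ⟨σ, hσ⟩ := h.minimal T
    { tmul := fun a b => h.tmul b a
      add_left := fun a a' b => h.add_right b a a'
      add_right := fun a b b' => h.add_left b b' a
      smul_left := fun c a b => h.smul_right c b a
      smul_right := fun c a b => h.smul_left c b a
      mul_tmul := fun a a' b b' => h.mul_tmul b b' a a'
      star_tmul := fun a b => h.star_tmul b a
      norm_tmul := fun a b => by rw [h.norm_tmul, mul_comm]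
      dense_span := by
        have : {t : T | ∃ a b, h.tmul b a = t} = {t : T | ∃ a b, h.tmul a b = t} :=
          Set.ext fun t => exists_comm
        rw [this]
        exact h.dense_span }
  have h1 : σ 1 = 1 := by
    conv_lhs => rw [← hu]
    exact (hσ 1 1).trans hu
  exact ⟨{ σ with
    map_one' := h1
    commutes' := fun c => by
      change σ _ = _
      rw [Algebra.algebraMap_eq_smul_one, map_smul, h1] }, fun a b => hσ b a⟩

end TensorMap

section UnitalApproxUnitaryEquiv

open scoped CStarAlgebra

/-- Approximate unitary equivalence in a unital C*-algebra, witnessed by unitaries of the algebra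
itself. -/
def UnitalApproxUnitaryEquiv {A : Type v} {B : Type u} [CStarAlgebra B] (φ ψ : A → B) : Prop :=
  ∃ v : ℕ → unitary B, ∀ a, Tendsto (fun n => star (v n : B) * φ a * v n) atTop (𝓝 (ψ a))

variable {A : Type v} {B : Type u} [CStarAlgebra B] {φ ψ χ : A → B}

theorem DoubleCentralizer.coe_fst_one (v : 𝓜(ℂ, B)) : ((v.fst 1 : B) : 𝓜(ℂ, B)) = v := by
  have hl (x : B) : v.fst x = v.snd 1 * x := by simpa using (v.central 1 x).symm
  have hr (y : B) : v.snd y = y * v.fst 1 := by simpa using v.central y 1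
  ext x
  · simp [hl]
  · simp [hr x]

theorem DoubleCentralizer.norm_coe_eq (b : B) : ‖(b : 𝓜(ℂ, B))‖ = ‖b‖ := by
  rw [← DoubleCentralizer.norm_fst]
  simp

theorem ApproxUnitaryEquiv.unital (h : ApproxUnitaryEquiv φ ψ) :
    UnitalApproxUnitaryEquiv φ ψ := by
  obtain ⟨v, hv, hvt⟩ := h
  let c : B →⋆ₙₐ[ℂ] 𝓜(ℂ, B) := DoubleCentralizer.coeHom
  have hc : Function.Injective c := by
    rw [injective_iff_map_eq_zero]
    intro b hb
    rw [← norm_eq_zero, ← DoubleCentralizer.norm_coe_eq]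
    exact norm_eq_zero.mpr hb
  have hcv n : c ((v n).fst 1) = v n := DoubleCentralizer.coe_fst_one _
  have hc1 : c 1 = 1 := DoubleCentralizer.coe_fst_one 1
  refine ⟨fun n => ⟨(v n).fst 1, ?_⟩, fun a => ?_⟩
  · rw [Unitary.mem_iff]
    have := Unitary.mem_iff.mp (hv n)
    constructor <;> apply hc <;> simp [map_mul, map_star, hcv, hc1, this]
  · rw [tendsto_iff_norm_sub_tendsto_zero]
    refine (hvt a).congr fun n => ?_
    refine Eq.trans ?_ (DoubleCentralizer.norm_coe_eq _)
    change _ = ‖c (_ - _)‖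
    rw [map_sub, map_mul, map_mul, map_star, hcv]
    rfl

namespace UnitalApproxUnitaryEquiv

theorem symm (h : UnitalApproxUnitaryEquiv φ ψ) : UnitalApproxUnitaryEquiv ψ φ := by
  obtain ⟨v, hv⟩ := h
  refine ⟨fun n => star (v n), fun a => ?_⟩
  rw [tendsto_iff_norm_sub_tendsto_zero]
  refine (tendsto_iff_norm_sub_tendsto_zero.mp (hv a)).congr fun n => ?_
  rw [norm_sub_rev, ← CStarRing.norm_coe_unitary_mul (v n),
    ← CStarRing.norm_mul_coe_unitary _ (star (v n))]
  congr 1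
  simp [mul_sub, sub_mul, mul_assoc]
  simp [← mul_assoc]

theorem trans (h : UnitalApproxUnitaryEquiv φ ψ) (h' : UnitalApproxUnitaryEquiv ψ χ) :
    UnitalApproxUnitaryEquiv φ χ := by
  obtain ⟨v, hv⟩ := h
  obtain ⟨w, hw⟩ := h'
  refine ⟨fun n => v n * w n, fun a => ?_⟩
  have h0 : Tendsto (fun n => star (w n : B) * (star (v n : B) * φ a * v n - ψ a) * w n) atTop
      (𝓝 0) := by
    rw [tendsto_zero_iff_norm_tendsto_zero]
    refine (tendsto_iff_norm_sub_tendsto_zero.mp (hv a)).congr fun n => ?_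
    rw [CStarRing.norm_mul_coe_unitary, ← Unitary.coe_star (U := w n),
      CStarRing.norm_coe_unitary_mul]
  refine ((h0.add (hw a)).congr fun n => ?_).trans (by rw [zero_add])
  simp [mul_sub, sub_mul, mul_assoc]

theorem comp_right {A' : Type w} (h : UnitalApproxUnitaryEquiv φ ψ) (f : A' → A) :
    UnitalApproxUnitaryEquiv (φ ∘ f) (ψ ∘ f) := by
  obtain ⟨v, hv⟩ := h
  exact ⟨v, fun a => hv (f a)⟩

theorem comp_left {C : Type w} [CStarAlgebra C] (h : UnitalApproxUnitaryEquiv φ ψ)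
    (π : B →⋆ₐ[ℂ] C) : UnitalApproxUnitaryEquiv (π ∘ φ) (π ∘ ψ) := by
  obtain ⟨v, hv⟩ := h
  refine ⟨fun n => ⟨π (v n), Unitary.map_mem π (v n).2⟩, fun a => ?_⟩
  refine (((map_continuous π).tendsto _).comp (hv a)).congr fun n => ?_
  simp [map_mul, map_star]

end UnitalApproxUnitaryEquiv

theorem IsStronglySelfAbsorbing.unitalApproxUnitaryEquiv_id {D T : Type u} [CStarAlgebra D]
    [CStarAlgebra T] [TopologicalSpace.SeparableSpace D] {h : MinTensor D D T}
    (hs : IsStronglySelfAbsorbing h) (hu : h.tmul 1 1 = 1) (α : D →⋆ₐ[ℂ] D)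
    (hα : Function.Injective α) : UnitalApproxUnitaryEquiv α id := by
  obtain ⟨-, φ, hφ⟩ := hs
  replace hφ := hφ.unital
  obtain ⟨Φ, hΦ⟩ := h.exists_map_right hu α hα
  obtain ⟨σ, hσ⟩ := h.exists_flip hu
  have hsnd : UnitalApproxUnitaryEquiv h.snd (h.fst ∘ φ.symm ∘ h.snd) := by
    have := hφ.comp_right (φ.symm ∘ h.snd)
    rwa [show φ ∘ φ.symm ∘ h.snd = h.snd from funext fun d => φ.apply_symm_apply _] at this
  have hsndα : UnitalApproxUnitaryEquiv (h.snd ∘ α) h.snd := by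
    have := hsnd.comp_left Φ
    rw [show Φ ∘ h.snd = h.snd ∘ α from funext fun d => hΦ 1 d,
      show Φ ∘ h.fst ∘ φ.symm ∘ h.snd = h.fst ∘ φ.symm ∘ h.snd from
        funext fun d => (hΦ _ 1).trans (by rw [map_one]; rfl)] at this
    exact this.trans hsnd.symm
  have hfstα : UnitalApproxUnitaryEquiv (h.fst ∘ α) h.fst := by
    have := hsndα.comp_left σ
    rwa [show σ ∘ h.snd ∘ α = h.fst ∘ α from funext fun d => hσ 1 _,
      show σ ∘ h.snd = h.fst from funext fun d => hσ 1 d] at this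
  have := (((hφ.comp_right α).trans hfstα).trans hφ.symm).comp_left
    (φ.symm : T →⋆ₐ[ℂ] D)
  rwa [show (φ.symm : T →⋆ₐ[ℂ] D) ∘ φ ∘ α = α from funext fun d => φ.symm_apply_apply _,
    show (φ.symm : T →⋆ₐ[ℂ] D) ∘ φ = id from funext fun d => φ.symm_apply_apply d] at this

end UnitalApproxUnitaryEquiv

section Intertwining

open scoped CStarAlgebra

variable {D E : Type u} [CStarAlgebra D] [CStarAlgebra E]

theorem UnitalApproxUnitaryEquiv.exists_tendsto_conjStarAlgAut {A : Type v} {φ ψ : A → E}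
    (h : UnitalApproxUnitaryEquiv φ ψ) : ∃ v : ℕ → unitary E, ∀ a,
      Tendsto (fun n => Unitary.conjStarAlgAut ℂ E (v n) (φ a)) atTop (𝓝 (ψ a)) := by
  obtain ⟨v, hv⟩ := h
  refine ⟨fun n => star (v n), fun a => (hv a).congr fun n => ?_⟩
  simp [Unitary.conjStarAlgAut_apply]

theorem StarAlgEquiv.norm_apply (e : E ≃⋆ₐ[ℂ] D) (x : E) : ‖e x‖ = ‖x‖ :=
  NonUnitalStarAlgHom.norm_map e e.injective x

/-- Conjugates of `α` which are close to a given one and whose range is close to a given element. -/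
theorem exists_unitary_tendsto_conj {α : D →⋆ₐ[ℂ] E} {β : E →⋆ₐ[ℂ] D}
    (hβα : UnitalApproxUnitaryEquiv (β ∘ α) id) (hαβ : UnitalApproxUnitaryEquiv (α ∘ β) id)
    (u : unitary E) (y : E) :
    ∃ (w : ℕ → unitary E) (x : ℕ → D),
      (∀ d, Tendsto (fun n => Unitary.conjStarAlgAut ℂ E (w n) (α d)) atTop
        (𝓝 (Unitary.conjStarAlgAut ℂ E u (α d)))) ∧
      Tendsto (fun n => Unitary.conjStarAlgAut ℂ E (w n) (α (x n))) atTop (𝓝 y) := by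
  obtain ⟨v, hv⟩ := hβα.symm.exists_tendsto_conjStarAlgAut
  obtain ⟨z, hz⟩ := hαβ.exists_tendsto_conjStarAlgAut
  have hα : Continuous α := map_continuous α
  have hu : Continuous (Unitary.conjStarAlgAut ℂ E u) :=
    map_continuous _
  have hw (n : ℕ) (d : D) : Unitary.conjStarAlgAut ℂ E
      (u * z n * ⟨α (v n), Unitary.map_mem α (v n).2⟩) (α d) =
      Unitary.conjStarAlgAut ℂ E u (Unitary.conjStarAlgAut ℂ E (z n)
        (α (Unitary.conjStarAlgAut ℂ D (v n) d))) := by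
    simp [Unitary.conjStarAlgAut_apply, map_mul, map_star, mul_assoc]
  refine ⟨fun n => u * z n * ⟨α (v n), Unitary.map_mem α (v n).2⟩,
    fun n => (Unitary.conjStarAlgAut ℂ D (v n)).symm
      (β ((Unitary.conjStarAlgAut ℂ E u).symm y)), fun d => ?_, ?_⟩
  · simp_rw [hw]
    refine (hu.tendsto _).comp ?_
    have h0 : Tendsto (fun n => Unitary.conjStarAlgAut ℂ E (z n)
        (α (Unitary.conjStarAlgAut ℂ D (v n) d) - α (β (α d)))) atTop (𝓝 0) := by
      rw [tendsto_zero_iff_norm_tendsto_zero]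
      simp_rw [StarAlgEquiv.norm_apply]
      exact tendsto_iff_norm_sub_tendsto_zero.mp ((hα.tendsto _).comp (hv d))
    refine ((h0.add (hz (α d))).congr fun n => ?_).trans (by rw [zero_add]; rfl)
    rw [map_sub]
    exact sub_add_cancel _ _
  · simp_rw [hw, StarAlgEquiv.apply_symm_apply]
    have := (hu.tendsto _).comp (hz ((Unitary.conjStarAlgAut ℂ E u).symm y))
    rwa [id, StarAlgEquiv.apply_symm_apply] at this

/-- If conjugates of `α` converge on a dense sequence, they converge to a *-homomorphism. -/
theorem exists_starAlgHom_tendsto_conj (α : D →⋆ₐ[ℂ] E) {d : ℕ → D} (hd : DenseRange d)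
    {F : Filter (unitary E)} [F.NeBot] {x : ℕ → E}
    (hx : ∀ k, Tendsto (fun u => Unitary.conjStarAlgAut ℂ E u (α (d k))) F (𝓝 (x k))) :
    ∃ θ : D →⋆ₐ[ℂ] E,
      ∀ a, Tendsto (fun u => Unitary.conjStarAlgAut ℂ E u (α a)) F (𝓝 (θ a)) := by
  have hlip (u : unitary E) (a b : D) :
      dist (Unitary.conjStarAlgAut ℂ E u (α a)) (Unitary.conjStarAlgAut ℂ E u (α b)) ≤
        dist a b := by
    rw [dist_eq_norm, dist_eq_norm, ← map_sub, ← map_sub, StarAlgEquiv.norm_apply]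
    exact NonUnitalStarAlgHom.norm_apply_le α _
  have hlim (a : D) : ∃ y, Tendsto (fun u => Unitary.conjStarAlgAut ℂ E u (α a)) F (𝓝 y) := by
    refine CompleteSpace.complete (Metric.cauchy_iff.mpr ⟨inferInstance, fun ε hε => ?_⟩)
    obtain ⟨k, hk⟩ := hd.exists_dist_lt a (ε := ε / 4) (by positivity)
    have hk' := (hx k).eventually (Metric.ball_mem_nhds _ (show 0 < ε / 4 by positivity))
    refine ⟨_, image_mem_map hk', ?_⟩
    rintro _ ⟨u, hu, rfl⟩ _ ⟨u', hu', rfl⟩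
    change dist _ _ < _ at hu hu'
    change dist (Unitary.conjStarAlgAut ℂ E u (α a)) (Unitary.conjStarAlgAut ℂ E u' (α a)) < ε
    have h1 := hlip u a (d k)
    have h2 := hlip u' a (d k)
    have h3 := dist_triangle4_right (Unitary.conjStarAlgAut ℂ E u (α a))
      (Unitary.conjStarAlgAut ℂ E u' (α a)) (Unitary.conjStarAlgAut ℂ E u (α (d k)))
      (Unitary.conjStarAlgAut ℂ E u' (α (d k)))
    have h4 := dist_triangle_right (Unitary.conjStarAlgAut ℂ E u (α (d k)))
      (Unitary.conjStarAlgAut ℂ E u' (α (d k))) (x k)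
    linarith
  choose θ hθ using hlim
  have hc (c : ℂ) : θ (algebraMap ℂ D c) = algebraMap ℂ E c := by
    refine tendsto_nhds_unique (hθ _) (tendsto_const_nhds.congr fun u => ?_)
    rw [AlgHomClass.commutes, AlgHomClass.commutes]
  exact ⟨{
    toFun := θ
    map_one' := by simpa using hc 1
    map_mul' := fun a b => tendsto_nhds_unique (hθ _)
      (((hθ a).mul (hθ b)).congr fun u => by rw [map_mul, map_mul])
    map_zero' := by simpa using hc 0
    map_add' := fun a b => tendsto_nhds_unique (hθ _)
      (((hθ a).add (hθ b)).congr fun u => by rw [map_add, map_add])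
    commutes' := hc
    map_star' := fun a => tendsto_nhds_unique (hθ _)
      ((hθ a).star.congr fun u => by rw [map_star, map_star]) }, hθ⟩

/-- Elliott's two-sided approximate intertwining argument. -/
theorem nonempty_starAlgEquiv_of_unitalApproxUnitaryEquiv [TopologicalSpace.SeparableSpace D]
    [TopologicalSpace.SeparableSpace E] {α : D →⋆ₐ[ℂ] E} {β : E →⋆ₐ[ℂ] D}
    (hα : Function.Injective α)
    (hβα : UnitalApproxUnitaryEquiv (β ∘ α) id) (hαβ : UnitalApproxUnitaryEquiv (α ∘ β) id) :
    Nonempty (D ≃⋆ₐ[ℂ] E) := by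
  obtain ⟨d, hd⟩ := TopologicalSpace.exists_dense_seq D
  obtain ⟨e, he⟩ := TopologicalSpace.exists_dense_seq E
  let orb (u : unitary E) (k : ℕ) : E := Unitary.conjStarAlgAut ℂ E u (α (d k))
  let X : Set (ℕ → E) := closure (Set.range orb)
  let o (u : unitary E) : X := ⟨orb u, subset_closure ⟨u, rfl⟩⟩
  have ho : DenseRange o := by
    rw [DenseRange, Subtype.dense_iff, ← Set.range_comp]
    exact subset_rfl
  let U (j m : ℕ) : Set X := {x | ∃ k, dist (x.1 k) (e j) < 1 / (m + 1)}
  have hUo (j m : ℕ) : IsOpen (U j m) := by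
    simp only [U, Set.ofPred_exists]
    exact isOpen_iUnion fun k => isOpen_lt
      (((continuous_apply k).comp continuous_subtype_val).dist continuous_const) continuous_const
  have hUd (j m : ℕ) : Dense (U j m) := by
    refine Dense.of_closure (ho.mono ?_)
    rintro _ ⟨u, rfl⟩
    obtain ⟨w, x, hw, hx⟩ := exists_unitary_tendsto_conj hβα hαβ u (e j)
    have hwo : Tendsto (fun n => o (w n)) atTop (𝓝 (o u)) :=
      tendsto_subtype_rng.mpr (tendsto_pi_nhds.mpr fun k => hw (d k))
    refine mem_closure_of_tendsto hwo ?_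
    have hm : (0 : ℝ) < 1 / (m + 1) := by positivity
    filter_upwards [hx.eventually (Metric.ball_mem_nhds _ hm)] with n hn
    have hcont : Continuous fun a => dist (Unitary.conjStarAlgAut ℂ E (w n) (α a)) (e j) :=
      ((map_continuous (Unitary.conjStarAlgAut ℂ E (w n))).comp
        (map_continuous α)).dist continuous_const
    obtain ⟨k, hk⟩ := hd.exists_mem_open (isOpen_lt hcont continuous_const) ⟨x n, hn⟩
    exact ⟨k, hk⟩
  have : CompleteSpace X := isClosed_closure.completeSpace_coe
  have hdense : Dense (⋂ p : ℕ × ℕ, U p.1 p.2) :=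
    dense_iInter_of_isOpen (fun p => hUo _ _) fun p => hUd _ _
  have : Nonempty X := ⟨o 1⟩
  obtain ⟨⟨x, hxX⟩, hx⟩ := hdense.nonempty
  have hF : (comap orb (𝓝 x)).NeBot :=
    comap_neBot_iff_frequently.mpr (mem_closure_iff_frequently.mp hxX)
  have hFx : ∀ k, Tendsto (fun u => orb u k) (comap orb (𝓝 x)) (𝓝 (x k)) :=
    tendsto_pi_nhds.mp tendsto_comap
  obtain ⟨θ, hθ⟩ := exists_starAlgHom_tendsto_conj α hd hFx
  have hθd (k : ℕ) : θ (d k) = x k := tendsto_nhds_unique (hθ _) (hFx k)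
  have hnorm (a : D) : ‖θ a‖ = ‖a‖ := by
    refine tendsto_nhds_unique (hθ a).norm (tendsto_const_nhds.congr fun u => ?_)
    rw [StarAlgEquiv.norm_apply, NonUnitalStarAlgHom.norm_map α hα]
  have hiso : Isometry θ := AddMonoidHomClass.isometry_of_norm θ hnorm
  have hrange : DenseRange θ := by
    refine Dense.of_closure (he.mono ?_)
    rintro _ ⟨j, rfl⟩
    refine Metric.mem_closure_iff.mpr fun ε hε => ?_
    obtain ⟨m, hm⟩ := exists_nat_one_div_lt hε
    obtain ⟨k, hk⟩ := Set.mem_iInter.mp hx (j, m)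
    refine ⟨θ (d k), ⟨_, rfl⟩, ?_⟩
    rw [hθd, dist_comm]
    exact hk.trans hm
  refine ⟨StarAlgEquiv.ofBijective θ ⟨hiso.injective, fun y => ?_⟩⟩
  rw [← Set.mem_range, ← hiso.isClosedEmbedding.isClosed_range.closure_eq]
  exact hrange y

end Intertwining

/-- If two strongly self-absorbing C*-algebras embed unitally into each other, they are
isomorphic. -/
theorem stmt_19 {D E TD TE : Type u}
    [CStarAlgebra D] [CStarAlgebra E] [CStarAlgebra TD] [CStarAlgebra TE]
    [TopologicalSpace.SeparableSpace D] [TopologicalSpace.SeparableSpace E]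
    (hD : MinTensor D D TD) (hDu : hD.tmul 1 1 = 1)
    (hDssa : IsStronglySelfAbsorbing hD)
    (hE : MinTensor E E TE) (hEu : hE.tmul 1 1 = 1)
    (hEssa : IsStronglySelfAbsorbing hE)
    (ιD : D →⋆ₐ[ℂ] E) (hιD : Function.Injective ιD)
    (ιE : E →⋆ₐ[ℂ] D) (hιE : Function.Injective ιE) :
    Nonempty (D ≃⋆ₐ[ℂ] E) := by
  exact nonempty_starAlgEquiv_of_unitalApproxUnitaryEquiv hιD
    (hDssa.unitalApproxUnitaryEquiv_id hDu (ιE.comp ιD) (hιE.comp hιD))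
    (hEssa.unitalApproxUnitaryEquiv_id hEu (ιD.comp ιE) (hιD.comp hιE))
end
end
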